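/- In the Setup: let H be a loose Hamilton cycle in G and P_0 ⊆ H a loose path of length t. Let E_p ⊆ E(H) be a random subset obtained by including each edge of H independently with probability p = (m-1)(k-1)/n, let 𝒫_p be the collection of increasing paths of length t in H starting from the edges of E_p, and let 𝒫_* = 𝒫_p ∪ {P_0}. Then with probability at least 1/m, the collection 𝒫_* is a t-balanced m-splitting of H that is suitable for P_0, and moreover δ_j(G[V(𝒫_*)]) ≥ (δ_j^k(1)+3ε/4)·M^{k-j}. -/

import Mathlib

open Finset

open scoped Classical

noncomputable section

/-- A `k`-uniform hypergraph with vertices drawn from `ℕ`. -/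
structure HGraph (k : ℕ) where
  verts : Finset ℕ
  edges : Finset (Finset ℕ)
  edge_sub : ∀ e ∈ edges, e ⊆ verts
  edge_card : ∀ e ∈ edges, e.card = k

namespace HGraph

variable {k : ℕ}

/-- The number of edges of `G` containing the vertex set `S`. -/
def degOn (G : HGraph k) (S : Finset ℕ) : ℕ :=
  (G.edges.filter fun e => S ⊆ e).card

/-- The relative degree `deg_G(S; W)`: edges containing `S` whose other vertices lie in `W`. -/
def degIn (G : HGraph k) (S W : Finset ℕ) : ℕ :=
  (G.edges.filter fun e => S ⊆ e ∧ e \ S ⊆ W).card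

/-- The edge set of the induced subhypergraph `G[U]`. -/
def inducedEdges (G : HGraph k) (U : Finset ℕ) : Finset (Finset ℕ) :=
  G.edges.filter fun e => e ⊆ U

/-- `δ_j(G) ≥ d`. -/
def MinDegGe (G : HGraph k) (j : ℕ) (d : ℝ) : Prop :=
  ∀ T ⊆ G.verts, T.card = j → d ≤ (G.degOn T : ℝ)

/-- `δ_j(G[U]) ≥ d`. -/
def MinDegOnGe (G : HGraph k) (j : ℕ) (U : Finset ℕ) (d : ℝ) : Prop :=
  ∀ T ⊆ U, T.card = j → d ≤ (((G.inducedEdges U).filter fun e => T ⊆ e).card : ℝ)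

end HGraph

/-- A colouring is rainbow on a set of edges if distinct edges receive distinct colours. -/
def RainbowEdges (χ : Finset ℕ → ℕ) (E : Finset (Finset ℕ)) : Prop :=
  ∀ e ∈ E, ∀ f ∈ E, χ e = χ f → e = f

/-- `χ` is globally `b`-bounded on `G`: every colour class has at most `b` edges. -/
def GloballyBounded {k : ℕ} (G : HGraph k) (χ : Finset ℕ → ℕ) (b : ℝ) : Prop :=
  ∀ c : ℕ, ((G.edges.filter fun e => χ e = c).card : ℝ) ≤ b

/-- The number of edges of a loose Hamilton cycle of `G`. -/
def numE {k : ℕ} (G : HGraph k) : ℕ := G.verts.card / (k - 1)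

/-- A loose Hamilton cycle in `G`, recorded by a cyclic ordering of the vertices:
`σ` enumerates the vertices, and the `i`-th edge consists of the `k` consecutive
vertices starting at position `i(k-1)`, so that consecutive edges share exactly one
vertex (when `(k-1) ∣ |V(G)|`). -/
structure LooseHamCycle (k : ℕ) (G : HGraph k) where
  σ : ℕ → ℕ
  injOn : Set.InjOn σ (Set.Iio G.verts.card)
  image_eq : (Finset.range G.verts.card).image σ = G.verts
  edges_mem : ∀ i < numE G,
    (Finset.range k).image (fun r => σ ((i * (k - 1) + r) % G.verts.card)) ∈ G.edges

namespace LooseHamCycle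

variable {k : ℕ} {G : HGraph k}

/-- The `i`-th edge of the cycle. -/
def cedge (H : LooseHamCycle k G) (i : ℕ) : Finset ℕ :=
  (Finset.range k).image fun r => H.σ ((i * (k - 1) + r) % G.verts.card)

/-- The edge set of the cycle. -/
def cedges (H : LooseHamCycle k G) : Finset (Finset ℕ) :=
  (Finset.range (numE G)).image H.cedge

/-- The edge set of the increasing loose path of length `t` starting at edge `i`. -/
def pEdges (H : LooseHamCycle k G) (i t : ℕ) : Finset (Finset ℕ) :=
  (Finset.range t).image fun r => H.cedge ((i + r) % numE G)

/-- The vertex set of the increasing loose path of length `t` starting at edge `i`. -/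
def pVerts (H : LooseHamCycle k G) (i t : ℕ) : Finset ℕ :=
  (Finset.range (t * (k - 1) + 1)).image fun r => H.σ ((i * (k - 1) + r) % G.verts.card)

/-- The first endvertex of the increasing loose path starting at edge `i`. -/
def pEndA (H : LooseHamCycle k G) (i : ℕ) : ℕ := H.σ ((i * (k - 1)) % G.verts.card)

/-- The last endvertex of the increasing loose path of length `t` starting at edge `i`. -/
def pEndB (H : LooseHamCycle k G) (i t : ℕ) : ℕ :=
  H.σ ((i * (k - 1) + t * (k - 1)) % G.verts.card)

/-- The endvertex pair of the increasing loose path of length `t` starting at edge `i`. -/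
def pEnds (H : LooseHamCycle k G) (i t : ℕ) : Finset ℕ := {H.pEndA i, H.pEndB i t}

end LooseHamCycle

/-- The loose Hamilton cycle threshold `δ_j^k(1)`: the least `δ ≥ 0` such that for every
`ε > 0` all sufficiently large `k`-graphs `G` (with `(k-1) ∣ n`) satisfying
`δ_j(G) ≥ (δ+ε)n^{k-j}` contain a loose Hamilton cycle. -/
noncomputable def looseHamThreshold (j k : ℕ) : ℝ :=
  sInf {δ : ℝ | 0 ≤ δ ∧ ∀ ε : ℝ, 0 < ε → ∃ n₀ : ℕ, ∀ n : ℕ, n₀ ≤ n → (k - 1) ∣ n →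
    ∀ G : HGraph k, G.verts.card = n →
      G.MinDegGe j ((δ + ε) * (n : ℝ) ^ (k - j)) → Nonempty (LooseHamCycle k G)}

/-- `T = t(k-1)+1`. -/
def TOf (k t : ℕ) : ℕ := t * (k - 1) + 1
/-- `m̃ = t^{100k}`. -/
def mtOf (k t : ℕ) : ℕ := t ^ (100 * k)
/-- `m = T·m̃`. -/
def mOf (k t : ℕ) : ℕ := TOf k t * mtOf k t
/-- `M = T·m`. -/
def MOf (k t : ℕ) : ℕ := TOf k t * mOf k t

section Splittings

variable {k : ℕ} {G : HGraph k}

/-- `I` is the index set of a `t`-balanced splitting of `H`: a collection of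
pairwise vertex-disjoint increasing loose paths of length `t` of `H`. -/
def IsSplitting (H : LooseHamCycle k G) (t : ℕ) (I : Finset ℕ) : Prop :=
  (∀ i ∈ I, i < numE G) ∧
    ∀ i ∈ I, ∀ i' ∈ I, i ≠ i' → Disjoint (H.pVerts i t) (H.pVerts i' t)

/-- `V(𝒫)` for the splitting indexed by `I`. -/
def splitVerts (H : LooseHamCycle k G) (t : ℕ) (I : Finset ℕ) : Finset ℕ :=
  I.biUnion fun i => H.pVerts i t

/-- `V^E(𝒫)` for the splitting indexed by `I`. -/
def splitEnds (H : LooseHamCycle k G) (t : ℕ) (I : Finset ℕ) : Finset ℕ :=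
  I.biUnion fun i => H.pEnds i t

/-- `V^I(𝒫)` for the splitting indexed by `I`. -/
def splitInt (H : LooseHamCycle k G) (t : ℕ) (I : Finset ℕ) : Finset ℕ :=
  splitVerts H t I \ splitEnds H t I

/-- A vertex set `S` is transverse with respect to the splitting indexed by `I`. -/
def Transverse (H : LooseHamCycle k G) (t : ℕ) (I : Finset ℕ) (S : Finset ℕ) : Prop :=
  ∀ i ∈ I, (S ∩ H.pVerts i t).card ≤ 1

/-- The splitting indexed by `I` is suitable for the path `P₀` (the increasing path
of length `t` starting at edge `i₀`). -/
def Suitable (χ : Finset ℕ → ℕ) (ε : ℝ) (m : ℕ) (H : LooseHamCycle k G)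
    (t : ℕ) (I : Finset ℕ) (i₀ : ℕ) : Prop :=
  (∀ S ⊆ splitVerts H t I \ H.pVerts i₀ t, S.card = k - 1 → Transverse H t I S →
    ((((G.inducedEdges (splitVerts H t I)).filter
        fun e => S ⊆ e ∧ ∃ f ∈ H.cedges, χ f = χ e).card : ℝ) ≤ ε * (m : ℝ) / 4)) ∧
  (∀ X ⊆ splitVerts H t I \ H.pVerts i₀ t, Transverse H t I X →
    ∀ e ∈ G.inducedEdges X, ∀ f ∈ G.inducedEdges X,
      χ e = χ f → (e ∩ f).card = 1 → False) ∧
  (∀ e ∈ G.inducedEdges (splitVerts H t I \ H.pVerts i₀ t),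
    ∀ f ∈ G.inducedEdges (splitVerts H t I \ H.pVerts i₀ t),
      χ e = χ f → Disjoint e f → Transverse H t I e → Transverse H t I f →
      ∃ i ∈ I, ∃ i' ∈ I, i ≠ i' ∧
        (H.pVerts i t ∩ e).Nonempty ∧ (H.pVerts i t ∩ f).Nonempty ∧
        (H.pVerts i' t ∩ e).Nonempty ∧ (H.pVerts i' t ∩ f).Nonempty)

/-- The cyclic successor of `i` within the index set `I`. -/
def nextIdx (I : Finset ℕ) (i : ℕ) : ℕ :=
  if h : (I.filter fun i' => i < i').Nonempty then (I.filter fun i' => i < i').min' h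
  else if h2 : I.Nonempty then I.min' h2 else 0

/-- `M` is a rerouting of the splitting indexed by `I`: a partition of `V^E(𝒫)` into
pairs such that identifying the two vertices of each pair connects the paths of
`H[V(G) ∖ V^I(𝒫)]` into a single loose cycle (the arcs of `H` between consecutive
paths of the splitting, together with the identified pairs, form a connected graph). -/
def IsRerouting (H : LooseHamCycle k G) (t : ℕ) (I : Finset ℕ)
    (M : Finset (Finset ℕ)) : Prop :=
  (∀ p ∈ M, p.card = 2 ∧ p ⊆ splitEnds H t I) ∧
  (∀ p ∈ M, ∀ q ∈ M, p ≠ q → Disjoint p q) ∧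
  M.biUnion id = splitEnds H t I ∧
  ∀ u ∈ splitEnds H t I, ∀ v ∈ splitEnds H t I,
    Relation.ReflTransGen
      (fun a b => ({a, b} : Finset ℕ) ∈ M ∨
        ∃ i ∈ I, ({a, b} : Finset ℕ) = {H.pEndB i t, H.pEndA (nextIdx I i)}) u v

/-- `X` (indexed over `Finset.range T`) is a viable partition of `V(𝒫)` for the
`t`-balanced splitting indexed by `I`. -/
def IsViablePartition (j : ℕ) (ε : ℝ) (t : ℕ) (H : LooseHamCycle k G)
    (I : Finset ℕ) (X : ℕ → Finset ℕ) : Prop :=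
  (Finset.range (TOf k t)).biUnion X = splitVerts H t I ∧
  (∀ h ∈ Finset.range (TOf k t), ∀ h' ∈ Finset.range (TOf k t), h ≠ h' →
    Disjoint (X h) (X h')) ∧
  (∀ h ∈ Finset.range (TOf k t), Transverse H t I (X h)) ∧
  (∃ M : Finset (Finset ℕ), IsRerouting H t I M ∧
    ∀ h ∈ Finset.range (TOf k t), (M.filter fun p => p ⊆ X h).card = mtOf k t) ∧
  ∀ h ∈ Finset.range (TOf k t),
    G.MinDegOnGe j (X h) ((looseHamThreshold j k + ε / 2) * (mOf k t : ℝ) ^ (k - j))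

/-- The vertex set spanned by a set of edges. -/
def eVerts (E : Finset (Finset ℕ)) : Finset ℕ := E.biUnion id

/-- `(𝒫, H', 𝒫')` is a `(P₀,H)`-switching of size `m`, where `𝒫` is the `t`-balanced
splitting of `H` indexed by `I` containing `P₀` (the increasing path of length `t`
starting at edge `i₀`), and `𝒫'` is the `2t`-bounded splitting of `H'` whose paths are
recorded in `Q` as pairs (edge set, endvertex pair). -/
def IsSwitching (t m : ℕ) (H : LooseHamCycle k G) (i₀ : ℕ) (I : Finset ℕ)
    (H' : LooseHamCycle k G) (Q : Finset (Finset (Finset ℕ) × Finset ℕ)) : Prop :=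
  IsSplitting H t I ∧ I.card = m ∧ i₀ ∈ I ∧
  Q.card = m ∧
  (∀ q ∈ Q, ∃ i ℓ : ℕ, i < numE G ∧ 1 ≤ ℓ ∧ ℓ ≤ 2 * t ∧
    q.1 = H'.pEdges i ℓ ∧ q.2 = H'.pEnds i ℓ) ∧
  (∀ q ∈ Q, ∀ q' ∈ Q, q ≠ q' → Disjoint (eVerts q.1) (eVerts q'.1)) ∧
  splitInt H t I = (Q.biUnion fun q => eVerts q.1) \ (Q.biUnion fun q => q.2) ∧
  H.cedges.filter (fun e => e ⊆ G.verts \ splitInt H t I) =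
    H'.cedges.filter (fun e =>
      e ⊆ G.verts \ ((Q.biUnion fun q => eVerts q.1) \ (Q.biUnion fun q => q.2))) ∧
  ∀ q ∈ Q, (H.pVerts i₀ t ∩ eVerts q.1).card ≤ 1

/-- A feasible `(P₀,H)`-switching: additionally `F' = H'[V(𝒫') ∖ V(P₀)]` is rainbow and
no edge of `F'` shares a colour with an edge of `H[V(G) ∖ V^I(𝒫)]`. -/
def IsFeasibleSwitching (χ : Finset ℕ → ℕ) (t m : ℕ) (H : LooseHamCycle k G)
    (i₀ : ℕ) (I : Finset ℕ) (H' : LooseHamCycle k G)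
    (Q : Finset (Finset (Finset ℕ) × Finset ℕ)) : Prop :=
  IsSwitching t m H i₀ I H' Q ∧
  RainbowEdges χ (H'.cedges.filter fun e =>
    e ⊆ (Q.biUnion fun q => eVerts q.1) \ H.pVerts i₀ t) ∧
  ∀ e ∈ H'.cedges.filter (fun e =>
      e ⊆ (Q.biUnion fun q => eVerts q.1) \ H.pVerts i₀ t),
    ∀ f ∈ H.cedges.filter (fun f => f ⊆ G.verts \ splitInt H t I), χ e ≠ χ f

/-- Two vertices are close (with respect to `H` and `t`) if they lie in edges of `H`
both contained in a loose path of `H` of length at most `2t+1`. -/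
def Close (H : LooseHamCycle k G) (t : ℕ) (u v : ℕ) : Prop :=
  ∃ i < numE G, ∃ i' < numE G, u ∈ H.cedge i ∧ v ∈ H.cedge i' ∧
    ∃ d ≤ 2 * t, (i + d) % numE G = i' ∨ (i' + d) % numE G = i

/-- A vertex set is spread if no two of its vertices are close. -/
def SpreadSet (H : LooseHamCycle k G) (t : ℕ) (S : Finset ℕ) : Prop :=
  ∀ u ∈ S, ∀ v ∈ S, u ≠ v → ¬ Close H t u v

/-- A vertex set is almost spread if exactly one pair of its vertices is close. -/
def AlmostSpreadSet (H : LooseHamCycle k G) (t : ℕ) (S : Finset ℕ) : Prop :=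
  ∃ u ∈ S, ∃ v ∈ S, u ≠ v ∧ Close H t u v ∧
    ∀ u' ∈ S, ∀ v' ∈ S, u' ≠ v' → Close H t u' v' → ({u', v'} : Finset ℕ) = {u, v}

end Splittings

/-- The probability that a `p`-random subset of `Finset.range N` (each element included
independently with probability `p`) satisfies `A`. -/
noncomputable def probOver (N : ℕ) (p : ℝ) (A : Finset ℕ → Prop) : ℝ :=
  ∑ S ∈ (Finset.range N).powerset,
    if A S then p ^ S.card * (1 - p) ^ (N - S.card) else 0

/-- A loose path of length `t` in `G`, recorded by an ordering of its vertices. -/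
structure LoosePath (k t : ℕ) (G : HGraph k) where
  σ : ℕ → ℕ
  injOn : Set.InjOn σ (Set.Iio (t * (k - 1) + 1))
  mem_verts : ∀ r < t * (k - 1) + 1, σ r ∈ G.verts
  edges_mem : ∀ i < t, (Finset.range k).image (fun r => σ (i * (k - 1) + r)) ∈ G.edges

namespace LoosePath

variable {k t : ℕ} {G : HGraph k}

/-- The vertex set of a loose path. -/
def verts (P : LoosePath k t G) : Finset ℕ := (Finset.range (t * (k - 1) + 1)).image P.σ

/-- The edge set of a loose path. -/
def edgeSet (P : LoosePath k t G) : Finset (Finset ℕ) :=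
  (Finset.range t).image fun i => (Finset.range k).image fun r => P.σ (i * (k - 1) + r)

/-- The first endvertex of a loose path. -/
def endA (P : LoosePath k t G) : ℕ := P.σ 0

/-- The last endvertex of a loose path. -/
def endB (P : LoosePath k t G) : ℕ := P.σ (t * (k - 1))

end LoosePath

lemma vec_card (d : ℕ) (W : Finset ℕ) (hW : W.card = d) :
    ((Fintype.piFinset (fun _ : Fin d => W)).filter Function.Injective).card = d.factorial := by
  have h1 : Fintype.card (Fin d ↪ W) = d.factorial := by
    rw [Fintype.card_embedding_eq]
    simp [hW, Nat.descFactorial_self]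
  rw [← h1, ← Finset.card_univ]
  symm
  refine Finset.card_bij (fun f _ => fun i => (f i : ℕ)) ?_ ?_ ?_
  · intro f _
    simp only [mem_filter, Fintype.mem_piFinset]
    exact ⟨fun i => (f i).2, fun a b h => f.injective (Subtype.ext h)⟩
  · intro f _ g _ h
    ext i
    exact congrFun h i
  · intro v hv
    simp only [mem_filter, Fintype.mem_piFinset] at hv
    exact ⟨⟨fun i => ⟨v i, hv.1 i⟩, fun a b h => hv.2 (by simpa using h)⟩, mem_univ _, rfl⟩

lemma coord_fiber {ι κ α : Type*} [Fintype ι] [Fintype κ] [Fintype α]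
    (a : ι → κ) (ha : Function.Injective a) (y : ι → α) :
    (univ.filter (fun x : κ → α => (fun i => x (a i)) = y)).card * Fintype.card α ^ Fintype.card ι
      = Fintype.card α ^ Fintype.card κ := by
  have h1 : (univ.filter (fun x : κ → α => (fun i => x (a i)) = y)) =
      Fintype.piFinset (fun c => if h : ∃ i, a i = c then {y h.choose} else univ) := by
    ext x
    simp only [mem_filter, mem_univ, true_and, Fintype.mem_piFinset]
    constructor
    · rintro rfl c
      split_ifs with h
      · have := h.choose_spec
        simp [this]
      · simp
    · intro h
      funext i
      have := h (a i)
      have h2 : ∃ i', a i' = a i := ⟨i, rfl⟩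
      rw [dif_pos h2] at this
      have h3 := ha h2.choose_spec
      rw [h3] at this
      simpa using this
  rw [h1, Fintype.card_piFinset]
  have h2 : ∀ c, (if h : ∃ i, a i = c then ({y h.choose} : Finset α) else univ).card
      = if c ∈ univ.image a then 1 else Fintype.card α := by
    intro c
    by_cases h : ∃ i, a i = c
    · rw [dif_pos h, if_pos (by simpa using h)]; simp
    · rw [dif_neg h, if_neg (by simpa using h)]; simp
  simp_rw [h2]
  rw [Finset.prod_ite, Finset.prod_const_one, Finset.prod_const, one_mul, ← pow_add]
  congr 1
  have h3 : (univ.filter (fun c => c ∉ univ.image a)).card + (univ.image a).card = Fintype.card κ := by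
    have := Finset.card_filter_add_card_filter_not (s := (univ : Finset κ)) (fun c => c ∈ univ.image a)
    rw [Finset.filter_mem_eq_inter, univ_inter, card_univ] at this
    omega
  rw [Finset.card_image_of_injective _ ha, card_univ] at h3
  exact h3

lemma coord_sum {ι κ α : Type*} [Fintype ι] [Fintype κ] [Fintype α]
    (a : ι → κ) (ha : Function.Injective a) (F : (ι → α) → ℕ) :
    (∑ x : κ → α, F (fun i => x (a i))) * Fintype.card α ^ Fintype.card ι
      = (∑ y, F y) * Fintype.card α ^ Fintype.card κ := by
  have h := Finset.sum_fiberwise (s := (univ : Finset (κ → α))) (g := fun x => (fun i => x (a i)))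
    (f := fun x => F (fun i => x (a i)))
  rw [← h, Finset.sum_mul, Finset.sum_mul]
  refine Finset.sum_congr rfl fun y _ => ?_
  rw [← coord_fiber a ha y, ← mul_assoc]
  congr 1
  rw [Finset.sum_congr rfl (g := fun _ => F y)]
  · simp [mul_comm]
  · intro x hx
    simp only [mem_filter, mem_univ, true_and] at hx
    rw [hx]

lemma coord_card {ι κ α : Type*} [Fintype ι] [Fintype κ] [Fintype α]
    (a : ι → κ) (ha : Function.Injective a) (P : (ι → α) → Prop) :
    (univ.filter (fun x : κ → α => P (fun i => x (a i)))).card * Fintype.card α ^ Fintype.card ι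
      = (univ.filter P).card * Fintype.card α ^ Fintype.card κ := by
  have := coord_sum a ha (fun y => if P y then 1 else 0)
  simpa [Finset.sum_boole] using this

lemma swap_card {κ α : Type*} [Fintype κ] [Fintype α] [Nonempty α]
    (A : Finset κ) (Q : (κ → α) → (κ → α) → Prop)
    (hQ : ∀ x y, Q x y ↔ Q (A.piecewise y x) (A.piecewise y x)) (η : ℝ)
    (h : ∀ y, ((univ.filter (fun x => Q x y)).card : ℝ) ≤ η) :
    ((univ.filter (fun x => Q x x)).card : ℝ) ≤ η := by
  have e1 : (univ.filter (fun p : (κ → α) × (κ → α) => Q p.1 p.2)).card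
      = (univ.filter (fun p : (κ → α) × (κ → α) => Q p.1 p.1)).card := by
    refine Finset.card_bij' (fun p _ => (A.piecewise p.2 p.1, A.piecewise p.1 p.2))
      (fun p _ => (A.piecewise p.2 p.1, A.piecewise p.1 p.2)) ?_ ?_ ?_ ?_
    · intro p hp
      simp only [mem_filter, mem_univ, true_and] at hp ⊢
      exact (hQ _ _).1 hp
    · intro p hp
      simp only [mem_filter, mem_univ, true_and] at hp ⊢
      rw [hQ]
      convert hp using 1 <;>
      · funext c
        by_cases hc : c ∈ A <;> simp [Finset.piecewise, hc]
    · intro p _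
      ext c <;> by_cases hc : c ∈ A <;> simp [Finset.piecewise, hc]
    · intro p _
      ext c <;> by_cases hc : c ∈ A <;> simp [Finset.piecewise, hc]
  have e2 : (univ.filter (fun p : (κ → α) × (κ → α) => Q p.1 p.1)).card
      = (univ.filter (fun x => Q x x)).card * Fintype.card (κ → α) := by
    rw [← Finset.card_univ, ← Finset.card_product]
    congr 1
    ext p; simp
  have e3 : ((univ.filter (fun p : (κ → α) × (κ → α) => Q p.1 p.2)).card : ℝ)
      ≤ Fintype.card (κ → α) * η := by
    have : (univ.filter (fun p : (κ → α) × (κ → α) => Q p.1 p.2)).card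
      = ∑ y, (univ.filter (fun x => Q x y)).card := by
      rw [Finset.card_eq_sum_card_fiberwise (f := Prod.snd) (t := univ) (by simp)]
      refine Finset.sum_congr rfl fun y _ => ?_
      refine Finset.card_bij' (fun p _ => p.1) (fun x _ => (x, y)) ?_ ?_ ?_ ?_
      · rintro ⟨a, b⟩; simp only [mem_filter, mem_univ, true_and]; rintro ⟨h1, rfl⟩; exact h1
      · intro x; simp
      · rintro ⟨a, b⟩; simp only [mem_filter, mem_univ, true_and]; rintro ⟨h1, rfl⟩; rfl
      · intro x; simp
    rw [this]; push_cast
    calc _ ≤ ∑ y : κ → α, η := Finset.sum_le_sum fun y _ => h y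
      _ = _ := by simp [Finset.sum_const, nsmul_eq_mul]
  rw [e1, e2] at e3
  push_cast at e3
  have hpos : (0:ℝ) < Fintype.card (κ → α) := by exact_mod_cast Fintype.card_pos
  nlinarith

lemma exp_sum_le {α : Type*} [Fintype α] (g : α → ℝ) (c : ℝ)
    (hs : ∑ a, g a = 0) (hg : ∀ a, |g a| ≤ c) :
    ∑ a, Real.exp (g a) ≤ Fintype.card α * Real.exp (c ^ 2 / 2) := by
  rcases isEmpty_or_nonempty α with he | ⟨⟨a0⟩⟩
  · simp
  have hc0 : 0 ≤ c := (abs_nonneg _).trans (hg a0)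
  rcases hc0.eq_or_lt with h0 | hc
  · subst h0
    have : ∀ a, g a = 0 := fun a => abs_nonpos_iff.1 (hg a)
    simp [this]
  have key : ∀ a, Real.exp (g a) ≤ Real.cosh c + g a / c * Real.sinh c := by
    intro a
    have hb := abs_le.1 (hg a)
    have p1 : 0 ≤ (c - g a) / (2 * c) := div_nonneg (by linarith) (by linarith)
    have p2 : 0 ≤ (c + g a) / (2 * c) := div_nonneg (by linarith) (by linarith)
    have p3 : (c - g a) / (2 * c) + (c + g a) / (2 * c) = 1 := by field_simp; ring
    have hconv := convexOn_exp.2 (Set.mem_univ (-c)) (Set.mem_univ c) p1 p2 p3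
    simp only [smul_eq_mul] at hconv
    have e1 : (c - g a) / (2 * c) * -c + (c + g a) / (2 * c) * c = g a := by field_simp; ring
    rw [e1] at hconv
    refine hconv.trans (le_of_eq ?_)
    rw [Real.cosh_eq, Real.sinh_eq]
    field_simp
    ring
  calc ∑ a, Real.exp (g a) ≤ ∑ a, (Real.cosh c + g a / c * Real.sinh c) :=
        Finset.sum_le_sum fun a _ => key a
    _ = Fintype.card α * Real.cosh c := by
        rw [Finset.sum_add_distrib, ← Finset.sum_mul, ← Finset.sum_div, hs]
        simp
    _ ≤ _ := by
        gcongr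
        exact Real.cosh_le_exp_half_sq c

lemma mgf_bound {α : Type*} [Fintype α] [Nonempty α] (c : ℝ) (s : ℝ) :
    ∀ (L : ℕ) (f : (Fin L → α) → ℝ) (μ : ℝ)
      (_ : ∀ x b y, |f x - f (Function.update x b y)| ≤ c)
      (_ : ∑ x, f x = Fintype.card α ^ L * μ),
      ∑ x, Real.exp (s * (f x - μ)) ≤ Fintype.card α ^ L * Real.exp (L * ((s * c) ^ 2 / 2)) := by
  intro L
  induction L with
  | zero =>
    intro f μ _ h
    simp at h
    simp [h]
  | succ L ih =>
    intro f μ hf h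
    have hpos : (0:ℝ) < Fintype.card α := by exact_mod_cast Fintype.card_pos
    have hsum : ∀ F : (Fin (L+1) → α) → ℝ,
        ∑ x, F x = ∑ x0 : α, ∑ x' : Fin L → α, F (Fin.cons x0 x') := by
      intro F
      rw [← Fintype.sum_prod_type']
      exact (Fintype.sum_equiv (Fin.consEquiv (fun _ => α)) _ _ (fun p => rfl)).symm
    set g : α → ℝ := fun x0 => (∑ x', f (Fin.cons x0 x')) / Fintype.card α ^ L with hgdef
    have hgs : ∀ x0, ∑ x', f (Fin.cons x0 x') = Fintype.card α ^ L * g x0 := by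
      intro x0; simp only [hgdef]; field_simp
    have hgd : ∀ x0 y0, |g x0 - g y0| ≤ c := by
      intro x0 y0
      simp only [hgdef]
      rw [← sub_div, abs_div, abs_of_pos (pow_pos hpos L), div_le_iff₀ (pow_pos hpos L),
        ← Finset.sum_sub_distrib]
      refine (Finset.abs_sum_le_sum_abs _ _).trans ?_
      calc _ ≤ ∑ x' : Fin L → α, c := by
            refine Finset.sum_le_sum fun x' _ => ?_
            have := hf (Fin.cons x0 x') 0 y0
            rwa [Fin.update_cons_zero] at this
        _ = _ := by simp [mul_comm]
    have hmean : ∑ x0, g x0 = Fintype.card α * μ := by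
      have h2 := hsum f
      simp_rw [hgs] at h2
      rw [← Finset.mul_sum, h, pow_succ, mul_assoc] at h2
      exact (mul_left_cancel₀ (pow_pos hpos L).ne' h2).symm
    have hgm : ∀ x0, |s * (g x0 - μ)| ≤ |s| * c := by
      intro x0
      rw [abs_mul]
      gcongr
      have : Fintype.card α * (g x0 - μ) = ∑ y0, (g x0 - g y0) := by
        rw [Finset.sum_sub_distrib, hmean]; simp; ring
      have h3 : Fintype.card α * |g x0 - μ| ≤ Fintype.card α * c := by
        rw [← abs_of_pos hpos, ← abs_mul, abs_of_pos hpos, this]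
        refine (Finset.abs_sum_le_sum_abs _ _).trans ?_
        refine (Finset.sum_le_sum fun y0 _ => hgd x0 y0).trans ?_
        simp
      exact le_of_mul_le_mul_left h3 hpos
    rw [hsum]
    calc ∑ x0 : α, ∑ x' : Fin L → α, Real.exp (s * (f (Fin.cons x0 x') - μ))
        = ∑ x0 : α, Real.exp (s * (g x0 - μ)) *
            ∑ x' : Fin L → α, Real.exp (s * (f (Fin.cons x0 x') - g x0)) := by
          refine Finset.sum_congr rfl fun x0 _ => ?_
          rw [Finset.mul_sum]
          refine Finset.sum_congr rfl fun x' _ => ?_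
          rw [← Real.exp_add]; congr 1; ring
      _ ≤ ∑ x0 : α, Real.exp (s * (g x0 - μ)) *
            (Fintype.card α ^ L * Real.exp (L * ((s * c) ^ 2 / 2))) := by
          refine Finset.sum_le_sum fun x0 _ => ?_
          gcongr
          refine ih (fun x' => f (Fin.cons x0 x')) (g x0) ?_ (hgs x0)
          intro x b y
          have := hf (Fin.cons x0 x) b.succ y
          rwa [← Fin.cons_update] at this
      _ ≤ (Fintype.card α * Real.exp ((|s| * c) ^ 2 / 2)) *
            (Fintype.card α ^ L * Real.exp (L * ((s * c) ^ 2 / 2))) := by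
          rw [← Finset.sum_mul]
          gcongr
          refine exp_sum_le _ _ ?_ hgm
          rw [← Finset.mul_sum, Finset.sum_sub_distrib, hmean]; simp
      _ = _ := by
          rw [mul_pow, sq_abs, pow_succ]
          push_cast
          rw [add_mul, Real.exp_add, one_mul, mul_pow]; ring

lemma mcdiarmid {α : Type*} [Fintype α] [Nonempty α] (L : ℕ) (hL : 0 < L) (c : ℝ) (hc : 0 < c)
    (f : (Fin L → α) → ℝ) (μ a : ℝ) (ha : 0 ≤ a)
    (hf : ∀ x b y, |f x - f (Function.update x b y)| ≤ c)
    (hμ : Fintype.card α ^ L * (μ + a) ≤ ∑ x, f x) :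
    ((univ.filter (fun x => f x ≤ μ)).card : ℝ)
      ≤ Fintype.card α ^ L * Real.exp (- (a ^ 2 / (2 * L * c ^ 2))) := by
  have hpos : (0:ℝ) < Fintype.card α := by exact_mod_cast Fintype.card_pos
  have hL' : (0:ℝ) < L := by exact_mod_cast hL
  set ν := (∑ x, f x) / Fintype.card α ^ L with hν
  have hsum : ∑ x, f x = Fintype.card α ^ L * ν := by rw [hν]; field_simp
  have hge : μ + a ≤ ν := by
    rw [hsum] at hμ; exact le_of_mul_le_mul_left hμ (pow_pos hpos L)
  set s : ℝ := - (a / (L * c ^ 2)) with hs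
  have hm := mgf_bound c s L f ν hf hsum
  have h1 : ((univ.filter (fun x => f x ≤ μ)).card : ℝ) * Real.exp (a ^ 2 / (L * c ^ 2))
      ≤ ∑ x, Real.exp (s * (f x - ν)) := by
    calc _ = ∑ x ∈ univ.filter (fun x => f x ≤ μ), Real.exp (a ^ 2 / (L * c ^ 2)) := by simp
      _ ≤ ∑ x ∈ univ.filter (fun x => f x ≤ μ), Real.exp (s * (f x - ν)) := by
          refine Finset.sum_le_sum fun x hx => ?_
          simp only [mem_filter, mem_univ, true_and] at hx
          apply Real.exp_le_exp.2
          have : a ^ 2 / (L * c ^ 2) = (a / (L * c ^ 2)) * a := by ring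
          rw [this, hs, neg_mul, ← mul_neg]
          gcongr
          linarith
      _ ≤ _ := Finset.sum_le_sum_of_subset_of_nonneg (Finset.filter_subset _ _)
          (fun _ _ _ => (Real.exp_pos _).le)
  have h2 := h1.trans hm
  have e : Real.exp (L * ((s * c) ^ 2 / 2)) =
      Real.exp (- (a ^ 2 / (2 * L * c ^ 2))) * Real.exp (a ^ 2 / (L * c ^ 2)) := by
    rw [← Real.exp_add]; congr 1; rw [hs]; field_simp; ring
  rw [e, ← mul_assoc] at h2
  exact le_of_mul_le_mul_right h2 (Real.exp_pos _)

lemma binom_const (L N : ℕ) (hL : 36 ≤ L) (hN : L < N) :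
    2 / ((L : ℝ) + 1) ≤ ((L : ℝ) / N) ^ L * (1 - (L : ℝ) / N) ^ (N - L) * N ^ L / L.factorial := by
  have hL0 : (0:ℝ) < L := by exact_mod_cast (by omega : 0 < L)
  have hLN : (L:ℝ) < N := by exact_mod_cast hN
  have hN0 : (0:ℝ) < N := by linarith
  have h1 : Real.exp (-L) ≤ (1 - (L : ℝ) / N) ^ (N - L) := by
    have hD : (0:ℝ) < (N:ℝ) - L := by linarith
    have hb : (1 - (L : ℝ) / N) = (1 + (L:ℝ) / (N - L))⁻¹ := by
      field_simp; ring
    rw [hb, inv_pow, Real.exp_neg]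
    apply inv_anti₀ (by positivity)
    have := Real.add_one_le_exp ((L:ℝ) / (N - L))
    calc (1 + (L:ℝ) / (N - L)) ^ (N - L) ≤ (Real.exp ((L:ℝ) / (N - L))) ^ (N - L) := by
          gcongr; linarith
      _ = Real.exp L := by
          rw [← Real.exp_nat_mul]; congr 1
          rw [Nat.cast_sub hN.le]; field_simp
  have h2 : (L.factorial : ℝ) ≤ Real.exp 1 * Real.sqrt L * (L / Real.exp 1) ^ L := by
    have hst : Stirling.stirlingSeq L ≤ Stirling.stirlingSeq 1 := by
      have := Stirling.stirlingSeq'_antitone (Nat.zero_le (L - 1))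
      simpa [Function.comp, Nat.succ_eq_add_one, Nat.sub_add_cancel (by omega : 1 ≤ L)] using this
    rw [Stirling.stirlingSeq_one, Stirling.stirlingSeq] at hst
    rw [div_le_iff₀ (by positivity)] at hst
    refine hst.trans (le_of_eq ?_)
    rw [Real.sqrt_mul (by norm_num)]
    have : Real.sqrt 2 ≠ 0 := by positivity
    field_simp
  have h3 : ((L : ℝ) / N) ^ L * N ^ L = L ^ L := by
    rw [div_pow]; field_simp
  rw [div_le_div_iff₀ (by positivity) (by positivity)]
  have h4 : ((L : ℝ) / N) ^ L * (1 - (L : ℝ) / N) ^ (N - L) * N ^ L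
      = L ^ L * (1 - (L : ℝ) / N) ^ (N - L) := by rw [← h3]; ring
  rw [h4]
  have h5 : 2 * (Real.exp 1 * Real.sqrt L) ≤ L + 1 := by
    have hs6 : (6:ℝ) ≤ Real.sqrt L := by
      apply Real.le_sqrt_of_sq_le
      have : (36:ℝ) ≤ L := by exact_mod_cast hL
      linarith
    have hsq : Real.sqrt L * Real.sqrt L = L := Real.mul_self_sqrt hL0.le
    have := Real.exp_one_lt_d9
    nlinarith
  calc 2 * (L.factorial : ℝ) ≤ 2 * (Real.exp 1 * Real.sqrt L * (L / Real.exp 1) ^ L) := by gcongr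
    _ = (2 * (Real.exp 1 * Real.sqrt L)) * (L / Real.exp 1) ^ L := by ring
    _ ≤ (L + 1) * (L / Real.exp 1) ^ L := by gcongr
    _ = (L + 1) * (L ^ L * Real.exp (-L)) := by
        rw [div_pow, ← Real.exp_nat_mul, mul_one, Real.exp_neg]; rfl
    _ ≤ (L + 1) * (L ^ L * (1 - (L : ℝ) / N) ^ (N - L)) := by gcongr
    _ = _ := by ring

section Geo
variable {k : ℕ} {G : HGraph k}

def vtx (H : LooseHamCycle k G) (i r : ℕ) : ℕ := H.σ ((i * (k - 1) + r) % G.verts.card)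

lemma mem_pVerts (H : LooseHamCycle k G) (i t v : ℕ) :
    v ∈ H.pVerts i t ↔ ∃ r < t * (k - 1) + 1, vtx H i r = v := by
  simp [LooseHamCycle.pVerts, vtx]

lemma pVerts_card_le (H : LooseHamCycle k G) (i t : ℕ) : (H.pVerts i t).card ≤ t * (k - 1) + 1 := by
  unfold LooseHamCycle.pVerts
  exact Finset.card_image_le.trans (by simp)

lemma vtx_mem (H : LooseHamCycle k G) (hn : 0 < G.verts.card) (i r : ℕ) : vtx H i r ∈ G.verts := by
  have := H.image_eq
  rw [← this]
  exact mem_image_of_mem _ (mem_range.2 (Nat.mod_lt _ hn))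

lemma vtx_eq_mod (H : LooseHamCycle k G) (hn : 0 < G.verts.card) {i r i' r' : ℕ}
    (h : vtx H i r = vtx H i' r') :
    (i * (k - 1) + r) ≡ (i' * (k - 1) + r') [MOD G.verts.card] :=
  H.injOn (Set.mem_Iio.2 (Nat.mod_lt _ hn)) (Set.mem_Iio.2 (Nat.mod_lt _ hn)) h

lemma vtx_inj_right (H : LooseHamCycle k G) {i r r' : ℕ} (hr : r < G.verts.card)
    (hr' : r' < G.verts.card) (h : vtx H i r = vtx H i r') : r = r' := by
  have h1 := vtx_eq_mod H (by omega) h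
  exact (Nat.ModEq.add_left_cancel' _ h1).eq_of_lt_of_lt hr hr'

lemma vtx_inj_left (H : LooseHamCycle k G) (hk : 2 ≤ k) (hNK : G.verts.card = numE G * (k - 1))
    {i i' r : ℕ} (hi : i < numE G) (hi' : i' < numE G) (h : vtx H i r = vtx H i' r) : i = i' := by
  have hK : 0 < k - 1 := by omega
  have h1 := vtx_eq_mod H (by rw [hNK]; exact Nat.mul_pos (by omega) hK) h
  have h2 := Nat.ModEq.add_right_cancel' _ h1
  rw [hNK] at h2
  have h3 := h2.eq_of_lt_of_lt (Nat.mul_lt_mul_of_pos_right hi hK) (Nat.mul_lt_mul_of_pos_right hi' hK)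
  exact Nat.eq_of_mul_eq_mul_right hK h3

lemma starts_card_le (H : LooseHamCycle k G) (hk : 2 ≤ k) (hNK : G.verts.card = numE G * (k - 1))
    (t v : ℕ) :
    (univ.filter (fun i : Fin (numE G) => v ∈ H.pVerts i t)).card ≤ t * (k - 1) + 1 := by
  have h1 : (univ.filter (fun i : Fin (numE G) => v ∈ H.pVerts i t)) ⊆
      (range (t * (k - 1) + 1)).biUnion (fun r => univ.filter (fun i : Fin (numE G) => vtx H i r = v)) := by
    intro i hi
    simp only [mem_filter, mem_univ, true_and, mem_pVerts] at hi
    simpa using hi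
  refine (card_le_card h1).trans (card_biUnion_le.trans ?_)
  calc _ ≤ ∑ r ∈ range (t * (k - 1) + 1), 1 := by
        refine Finset.sum_le_sum fun r _ => ?_
        rw [Finset.card_le_one]
        intro i hi i' hi'
        simp only [mem_filter, mem_univ, true_and] at hi hi'
        exact Fin.ext (vtx_inj_left H hk hNK i.2 i'.2 (hi.trans hi'.symm))
    _ = _ := by simp

lemma nondisj_card_le (H : LooseHamCycle k G) (hk : 2 ≤ k) (hNK : G.verts.card = numE G * (k - 1))
    (t i : ℕ) :
    (univ.filter (fun i' : Fin (numE G) => ¬ Disjoint (H.pVerts i t) (H.pVerts i' t))).card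
      ≤ (t * (k - 1) + 1) ^ 2 := by
  have h1 : (univ.filter (fun i' : Fin (numE G) => ¬ Disjoint (H.pVerts i t) (H.pVerts i' t))) ⊆
      (H.pVerts i t).biUnion (fun v => univ.filter (fun i' : Fin (numE G) => v ∈ H.pVerts i' t)) := by
    intro i' hi
    simp only [mem_filter, mem_univ, true_and, Finset.not_disjoint_iff] at hi
    simpa using hi
  refine (card_le_card h1).trans (card_biUnion_le.trans ?_)
  refine (Finset.sum_le_card_nsmul _ _ _ (fun v _ => starts_card_le H hk hNK t v)).trans ?_
  rw [smul_eq_mul, sq]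
  exact Nat.mul_le_mul_right _ (pVerts_card_le H i t)

lemma fiber_ge (H : LooseHamCycle k G) (hk : 2 ≤ k) (hNK : G.verts.card = numE G * (k - 1))
    (t : ℕ) (ht : t ≤ numE G) (v : ℕ) (hv : v ∈ G.verts) :
    t ≤ (univ.filter (fun p : Fin (numE G) × Fin (t * (k - 1)) => vtx H p.1 p.2 = v)).card := by
  have hK : 0 < k - 1 := by omega
  have hvv := hv
  rw [← H.image_eq] at hvv
  obtain ⟨a, ha, rfl⟩ := mem_image.1 hvv
  rw [mem_range] at ha
  have hN : 0 < numE G := by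
    rcases Nat.eq_zero_or_pos (numE G) with h | h
    · rw [hNK, h] at ha; omega
    · exact h
  have hlt : ∀ q : Fin t, q.1 * (k - 1) + a % (k - 1) < t * (k - 1) := by
    intro q
    have h1 := Nat.mod_lt a hK
    have h2 : (q.1 + 1) * (k - 1) ≤ t * (k - 1) := Nat.mul_le_mul_right _ q.2
    rw [add_mul, one_mul] at h2
    omega
  let φ : Fin t → Fin (numE G) × Fin (t * (k - 1)) := fun q =>
    (⟨(a / (k - 1) + (numE G - q.1)) % numE G, Nat.mod_lt _ hN⟩, ⟨q.1 * (k - 1) + a % (k - 1), hlt q⟩)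
  have hφ : Function.Injective φ := by
    intro q q' h
    have h2 : q.1 * (k - 1) + a % (k - 1) = q'.1 * (k - 1) + a % (k - 1) := by
      have := congrArg (fun p => (p.2 : ℕ)) h
      simpa [φ] using this
    exact Fin.ext (Nat.eq_of_mul_eq_mul_right hK (by omega))
  have := Finset.card_le_card_of_injOn (s := univ) (t := (univ.filter (fun p : Fin (numE G) × Fin (t * (k - 1)) => vtx H p.1 p.2 = H.σ a))) φ ?_ hφ.injOn
  · simpa using this
  · intro q _
    refine mem_coe.2 (mem_filter.2 ⟨mem_univ _, ?_⟩)
    show H.σ (((a / (k - 1) + (numE G - q.1)) % numE G * (k - 1) + (q.1 * (k - 1) + a % (k - 1)))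
      % G.verts.card) = H.σ a
    congr 1
    rw [hNK] at ha ⊢
    rw [← Nat.mul_mod_mul_right, Nat.mod_add_mod]
    have hq : q.1 ≤ numE G := by omega
    have e1 : (a / (k - 1) + (numE G - q.1)) * (k - 1) + (q.1 * (k - 1) + a % (k - 1))
        = a + numE G * (k - 1) := by
      have e2 : (numE G - q.1) * (k - 1) + q.1 * (k - 1) = numE G * (k - 1) := by
        rw [← add_mul, Nat.sub_add_cancel hq]
      have e3 := Nat.div_add_mod' a (k - 1)
      rw [add_mul]; omega
    rw [e1, Nat.add_mod_right, Nat.mod_eq_of_lt ha]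

end Geo

lemma probOver_ge (N L : ℕ) (p : ℝ) (hp0 : 0 ≤ p) (hp1 : p ≤ 1) (A : Finset ℕ → Prop) :
    p ^ L * (1 - p) ^ (N - L) * ((univ.filter (fun x : Fin L → Fin N =>
      Function.Injective x ∧ A (univ.image (fun a => (x a : ℕ))))).card : ℝ) / L.factorial
      ≤ probOver N p A := by
  set X := univ.filter (fun x : Fin L → Fin N =>
      Function.Injective x ∧ A (univ.image (fun a => (x a : ℕ)))) with hX
  set Y := ((range N).powerset).filter (fun S => S.card = L ∧ A S) with hY
  have h1 : X.card ≤ L.factorial * Y.card := by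
    refine Finset.card_le_mul_card_image_of_maps_to (f := fun x => univ.image (fun a => (x a : ℕ))) ?_ _ ?_
    · intro x hx
      simp only [hX, hY, mem_filter, mem_univ, true_and, mem_powerset] at hx ⊢
      refine ⟨?_, ?_, hx.2⟩
      · intro i hi
        simp only [mem_image, mem_univ, true_and] at hi
        obtain ⟨a, rfl⟩ := hi
        simp
      · rw [Finset.card_image_of_injective _ (fun a b h => hx.1 (Fin.ext h))]; simp
    · intro S hS
      simp only [hY, mem_filter] at hS
      rw [← vec_card L S hS.2.1]
      refine Finset.card_le_card_of_injOn (fun x a => (x a : ℕ)) ?_ ?_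
      · intro x hx
        simp only [hX, coe_filter, mem_filter, mem_univ, true_and, Set.mem_ofPred_eq,
          Fintype.mem_piFinset] at hx ⊢
        refine ⟨fun a => ?_, fun a b h => hx.1.1 (Fin.ext h)⟩
        rw [← hx.2]
        exact mem_image_of_mem _ (mem_univ _)
      · intro x _ y _ h
        funext a
        exact Fin.ext (congrFun h a)
  have hw : 0 ≤ p ^ L * (1 - p) ^ (N - L) := mul_nonneg (pow_nonneg hp0 _) (pow_nonneg (by linarith) _)
  have h2 : p ^ L * (1 - p) ^ (N - L) * Y.card ≤ probOver N p A := by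
    unfold probOver
    calc _ = ∑ S ∈ Y, p ^ L * (1 - p) ^ (N - L) := by simp [mul_comm]
      _ = ∑ S ∈ Y, if A S then p ^ S.card * (1 - p) ^ (N - S.card) else 0 := by
          refine Finset.sum_congr rfl fun S hS => ?_
          simp only [hY, mem_filter] at hS
          rw [if_pos hS.2.2, hS.2.1]
      _ ≤ _ := by
          refine Finset.sum_le_sum_of_subset_of_nonneg (Finset.filter_subset _ _) ?_
          intro S _ _
          split_ifs
          · exact mul_nonneg (pow_nonneg hp0 _) (pow_nonneg (by linarith) _)
          · exact le_rfl
  refine le_trans ?_ h2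
  rw [div_le_iff₀ (by positivity), mul_assoc _ (Y.card : ℝ)]
  refine mul_le_mul_of_nonneg_left ?_ hw
  rw [mul_comm]
  exact_mod_cast h1

section Col
variable {k : ℕ} {G : HGraph k}

def BadSet (H : LooseHamCycle k G) (t : ℕ) {L : ℕ} (x : Fin L → Fin (numE G)) (U : Finset ℕ) : Prop :=
  ∃ φ : {v // v ∈ U} → Fin L, Function.Injective φ ∧ ∀ v, v.1 ∈ H.pVerts (x (φ v)) t

def idxSet {L N : ℕ} (i₀ : ℕ) (x : Fin L → Fin N) : Finset ℕ :=
  insert i₀ (univ.image (fun a => (x a : ℕ)))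

lemma badSet_card (H : LooseHamCycle k G) (hk : 2 ≤ k) (hNK : G.verts.card = numE G * (k - 1))
    (t L s : ℕ) (U : Finset ℕ) (hU : U.card = s) :
    (univ.filter (fun x : Fin L → Fin (numE G) => BadSet H t x U)).card * numE G ^ s
      ≤ (L * (t * (k - 1) + 1)) ^ s * numE G ^ L := by
  have h1 : (univ.filter (fun x : Fin L → Fin (numE G) => BadSet H t x U)) ⊆
      (univ.filter (fun φ : {v // v ∈ U} → Fin L => Function.Injective φ)).biUnion (fun φ =>
        univ.filter (fun x : Fin L → Fin (numE G) => ∀ v, v.1 ∈ H.pVerts (x (φ v)) t)) := by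
    intro x hx
    obtain ⟨φ, h1, h2⟩ := (mem_filter.1 hx).2
    simp only [mem_filter, mem_univ, true_and, mem_biUnion]
    exact ⟨φ, h1, h2⟩
  have h2 : ∀ φ ∈ (univ.filter (fun φ : {v // v ∈ U} → Fin L => Function.Injective φ)),
      (univ.filter (fun x : Fin L → Fin (numE G) => ∀ v, v.1 ∈ H.pVerts (x (φ v)) t)).card
        * numE G ^ s ≤ (t * (k - 1) + 1) ^ s * numE G ^ L := by
    intro φ hφ
    simp only [mem_filter, mem_univ, true_and] at hφ
    have := coord_card (α := Fin (numE G)) φ hφ (fun y => ∀ v, v.1 ∈ H.pVerts (y v) t)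
    simp only [Fintype.card_fin, Fintype.card_coe, hU] at this
    have this2 : (univ.filter (fun x : Fin L → Fin (numE G) => ∀ v, v.1 ∈ H.pVerts (x (φ v)) t)).card
        * numE G ^ s = (univ.filter (fun y : {v // v ∈ U} → Fin (numE G) =>
          ∀ v, v.1 ∈ H.pVerts (y v) t)).card * numE G ^ L := by convert this
    rw [this2]
    refine Nat.mul_le_mul_right _ ?_
    have e : (univ.filter (fun y : {v // v ∈ U} → Fin (numE G) => ∀ v, v.1 ∈ H.pVerts (y v) t))
        = Fintype.piFinset (fun v => univ.filter (fun i : Fin (numE G) => v.1 ∈ H.pVerts i t)) := by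
      ext y; simp
    rw [e, Fintype.card_piFinset]
    calc _ ≤ ∏ v : {v // v ∈ U}, (t * (k - 1) + 1) :=
          Finset.prod_le_prod' fun v _ => starts_card_le H hk hNK t v.1
      _ = _ := by simp [hU]
  calc _ ≤ (∑ φ ∈ (univ.filter (fun φ : {v // v ∈ U} → Fin L => Function.Injective φ)),
        (univ.filter (fun x : Fin L → Fin (numE G) => ∀ v, v.1 ∈ H.pVerts (x (φ v)) t)).card)
          * numE G ^ s := Nat.mul_le_mul_right _ ((card_le_card h1).trans card_biUnion_le)
    _ ≤ (univ.filter (fun φ : {v // v ∈ U} → Fin L => Function.Injective φ)).card *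
          ((t * (k - 1) + 1) ^ s * numE G ^ L) := by
        rw [Finset.sum_mul]
        simpa using Finset.sum_le_card_nsmul _ _ _ h2
    _ ≤ L ^ s * ((t * (k - 1) + 1) ^ s * numE G ^ L) := by
        refine Nat.mul_le_mul_right _ ((Finset.card_filter_le _ _).trans ?_)
        simp [hU]
    _ = _ := by rw [mul_pow, mul_assoc]

lemma badFam_card (H : LooseHamCycle k G) (hk : 2 ≤ k) (hNK : G.verts.card = numE G * (k - 1))
    (t L s : ℕ) (F : Finset (Finset ℕ)) (hF : ∀ U ∈ F, U.card = s) :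
    (univ.filter (fun x : Fin L → Fin (numE G) => ∃ U ∈ F, BadSet H t x U)).card * numE G ^ s
      ≤ F.card * ((L * (t * (k - 1) + 1)) ^ s * numE G ^ L) := by
  have h1 : (univ.filter (fun x : Fin L → Fin (numE G) => ∃ U ∈ F, BadSet H t x U)) ⊆
      F.biUnion (fun U => univ.filter (fun x : Fin L → Fin (numE G) => BadSet H t x U)) := by
    intro x hx
    simpa using hx
  calc _ ≤ (∑ U ∈ F, (univ.filter (fun x : Fin L → Fin (numE G) => BadSet H t x U)).card)
          * numE G ^ s := Nat.mul_le_mul_right _ ((card_le_card h1).trans card_biUnion_le)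
    _ ≤ _ := by
        rw [Finset.sum_mul]
        simpa using Finset.sum_le_card_nsmul _ _ _ (fun U hU => badSet_card H hk hNK t L s U (hF U hU))

lemma badFam_real (H : LooseHamCycle k G) (hk : 2 ≤ k) (hNK : G.verts.card = numE G * (k - 1))
    (hN : 0 < numE G)
    (t L s : ℕ) (F : Finset (Finset ℕ)) (hF : ∀ U ∈ F, U.card = s) (ρ : ℝ)
    (hρ : (F.card : ℝ) ≤ ρ * (G.verts.card : ℝ) ^ s) :
    ((univ.filter (fun x : Fin L → Fin (numE G) => ∃ U ∈ F, BadSet H t x U)).card : ℝ)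
      ≤ ρ * (((k - 1) * (L * (t * (k - 1) + 1)) : ℕ) : ℝ) ^ s * (numE G : ℝ) ^ L := by
  have h := badFam_card H hk hNK t L s F hF
  have hN' : (0:ℝ) < (numE G : ℝ) ^ s := by positivity
  have h' : ((univ.filter (fun x : Fin L → Fin (numE G) => ∃ U ∈ F, BadSet H t x U)).card : ℝ)
      * (numE G : ℝ) ^ s ≤ F.card * (((L * (t * (k - 1) + 1) : ℕ) : ℝ) ^ s * (numE G : ℝ) ^ L) := by
    exact_mod_cast h
  refine le_of_mul_le_mul_right (h'.trans ?_) hN'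
  calc _ ≤ (ρ * (G.verts.card : ℝ) ^ s) * (((L * (t * (k - 1) + 1) : ℕ) : ℝ) ^ s * (numE G : ℝ) ^ L) := by
        gcongr
    _ = _ := by
        rw [hNK, Nat.cast_mul (k - 1), Nat.cast_mul (numE G), mul_pow, mul_pow]; ring

def fam1 (G : HGraph k) (H : LooseHamCycle k G) (χ : Finset ℕ → ℕ) : Finset (Finset ℕ) :=
  G.edges.filter fun e => ∃ f ∈ H.cedges, χ f = χ e

def monoPairs (G : HGraph k) (χ : Finset ℕ → ℕ) : Finset (Finset ℕ × Finset ℕ) :=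
  (G.edges ×ˢ G.edges).filter fun p => χ p.1 = χ p.2

def fam2 (G : HGraph k) (χ : Finset ℕ → ℕ) : Finset (Finset ℕ) :=
  ((monoPairs G χ).filter fun p => (p.1 ∩ p.2).card = 1).image fun p => p.1 ∪ p.2

def fam3 (G : HGraph k) (χ : Finset ℕ → ℕ) : Finset (Finset ℕ) :=
  ((monoPairs G χ).filter fun p => Disjoint p.1 p.2).biUnion
    fun p => p.2.image fun v => p.1 ∪ p.2.erase v

lemma fam1_card (H : LooseHamCycle k G) (χ : Finset ℕ → ℕ) (hk : 2 ≤ k) (μ : ℝ) (hμ : 0 ≤ μ)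
    (hχ : GloballyBounded G χ (μ * (G.verts.card : ℝ) ^ (k - 1))) :
    ((fam1 G H χ).card : ℝ) ≤ μ * (G.verts.card : ℝ) ^ k := by
  have h1 : fam1 G H χ ⊆ H.cedges.biUnion fun f => G.edges.filter fun e => χ e = χ f := by
    intro e he
    simp only [fam1, mem_filter, mem_biUnion] at he ⊢
    obtain ⟨h1, f, hf, h2⟩ := he
    exact ⟨f, hf, h1, h2.symm⟩
  have h2 : H.cedges.card ≤ G.verts.card := by
    unfold LooseHamCycle.cedges
    refine card_image_le.trans ?_
    rw [card_range]
    exact Nat.div_le_self _ _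
  calc ((fam1 G H χ).card : ℝ) ≤ ∑ f ∈ H.cedges, ((G.edges.filter fun e => χ e = χ f).card : ℝ) := by
        exact_mod_cast (card_le_card h1).trans card_biUnion_le
    _ ≤ ∑ f ∈ H.cedges, μ * (G.verts.card : ℝ) ^ (k - 1) := Finset.sum_le_sum fun f _ => hχ _
    _ = H.cedges.card * (μ * (G.verts.card : ℝ) ^ (k - 1)) := by simp
    _ ≤ G.verts.card * (μ * (G.verts.card : ℝ) ^ (k - 1)) := by gcongr
    _ = _ := by
        obtain ⟨q, rfl⟩ : ∃ q, k = q + 1 := ⟨k - 1, by omega⟩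
        rw [Nat.add_sub_cancel, pow_succ]; ring

lemma edges_card_le (G : HGraph k) : G.edges.card ≤ G.verts.card ^ k := by
  have : G.edges ⊆ G.verts.powersetCard k := by
    intro e he
    exact mem_powersetCard.2 ⟨G.edge_sub e he, G.edge_card e he⟩
  refine (card_le_card this).trans ?_
  rw [card_powersetCard]
  exact Nat.choose_le_pow _ _

lemma monoPairs_card (χ : Finset ℕ → ℕ) (hk : 2 ≤ k) (μ : ℝ) (hμ : 0 ≤ μ)
    (hχ : GloballyBounded G χ (μ * (G.verts.card : ℝ) ^ (k - 1))) :
    ((monoPairs G χ).card : ℝ) ≤ μ * (G.verts.card : ℝ) ^ (2 * k - 1) := by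
  have h1 : monoPairs G χ ⊆ G.edges.biUnion fun e => (G.edges.filter fun f => χ f = χ e).image fun f => (e, f) := by
    rintro ⟨e, f⟩ he
    simp only [monoPairs, mem_filter, mem_product, mem_biUnion, mem_image] at he ⊢
    exact ⟨e, he.1.1, f, ⟨he.1.2, he.2.symm⟩, rfl⟩
  have h2 : (G.edges.card : ℝ) ≤ (G.verts.card : ℝ) ^ k := by exact_mod_cast edges_card_le G
  calc ((monoPairs G χ).card : ℝ) ≤ ∑ e ∈ G.edges, ((G.edges.filter fun f => χ f = χ e).card : ℝ) := by
        exact_mod_cast (card_le_card h1).trans (card_biUnion_le.trans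
          (Finset.sum_le_sum fun e _ => card_image_le))
    _ ≤ ∑ e ∈ G.edges, μ * (G.verts.card : ℝ) ^ (k - 1) := Finset.sum_le_sum fun f _ => hχ _
    _ = G.edges.card * (μ * (G.verts.card : ℝ) ^ (k - 1)) := by simp
    _ ≤ (G.verts.card : ℝ) ^ k * (μ * (G.verts.card : ℝ) ^ (k - 1)) := by gcongr
    _ = _ := by
        rw [show 2 * k - 1 = k + (k - 1) by omega, pow_add]; ring

lemma fam2_card (χ : Finset ℕ → ℕ) (hk : 2 ≤ k) (μ : ℝ) (hμ : 0 ≤ μ)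
    (hχ : GloballyBounded G χ (μ * (G.verts.card : ℝ) ^ (k - 1))) :
    ((fam2 G χ).card : ℝ) ≤ μ * (G.verts.card : ℝ) ^ (2 * k - 1) := by
  refine le_trans ?_ (monoPairs_card χ hk μ hμ hχ)
  exact_mod_cast card_image_le.trans (card_filter_le _ _)

lemma fam3_card (χ : Finset ℕ → ℕ) (hk : 2 ≤ k) (μ : ℝ) (hμ : 0 ≤ μ)
    (hχ : GloballyBounded G χ (μ * (G.verts.card : ℝ) ^ (k - 1))) :
    ((fam3 G χ).card : ℝ) ≤ (k * μ) * (G.verts.card : ℝ) ^ (2 * k - 1) := by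
  have h1 : (fam3 G χ).card ≤ (monoPairs G χ).card * k := by
    unfold fam3
    refine card_biUnion_le.trans ?_
    refine (Finset.sum_le_card_nsmul _ _ k ?_).trans ?_
    · intro p hp
      simp only [mem_filter, monoPairs, mem_product] at hp
      exact card_image_le.trans (G.edge_card _ hp.1.1.2).le
    · rw [smul_eq_mul]
      exact Nat.mul_le_mul_right _ (card_filter_le _ _)
  calc ((fam3 G χ).card : ℝ) ≤ (monoPairs G χ).card * k := by exact_mod_cast h1
    _ ≤ (μ * (G.verts.card : ℝ) ^ (2 * k - 1)) * k := by
        gcongr; exact monoPairs_card χ hk μ hμ hχ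
    _ = _ := by ring

lemma fam1_unif (H : LooseHamCycle k G) (χ : Finset ℕ → ℕ) : ∀ U ∈ fam1 G H χ, U.card = k := by
  intro U hU
  exact G.edge_card U (mem_filter.1 hU).1

lemma fam2_unif (χ : Finset ℕ → ℕ) : ∀ U ∈ fam2 G χ, U.card = 2 * k - 1 := by
  intro U hU
  simp only [fam2, monoPairs, mem_image, mem_filter, mem_product] at hU
  obtain ⟨p, ⟨⟨⟨h1, h2⟩, _⟩, h3⟩, rfl⟩ := hU
  have := card_union_add_card_inter p.1 p.2
  rw [G.edge_card _ h1, G.edge_card _ h2] at this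
  omega

lemma fam3_unif (χ : Finset ℕ → ℕ) : ∀ U ∈ fam3 G χ, U.card = 2 * k - 1 := by
  intro U hU
  simp only [fam3, monoPairs, mem_image, mem_filter, mem_product, mem_biUnion] at hU
  obtain ⟨p, ⟨⟨⟨h1, h2⟩, _⟩, h3⟩, v, hv, rfl⟩ := hU
  rw [card_union_of_disjoint (h3.mono_right (erase_subset _ _)), card_erase_of_mem hv,
    G.edge_card _ h1, G.edge_card _ h2]
  have : 0 < p.2.card := card_pos.2 ⟨v, hv⟩
  rw [G.edge_card _ h2] at this
  omega

lemma badSet_of_transverse (H : LooseHamCycle k G) (t i₀ : ℕ) {L : ℕ} (x : Fin L → Fin (numE G))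
    (U : Finset ℕ) (hU : U ⊆ splitVerts H t (idxSet i₀ x) \ H.pVerts i₀ t)
    (hT : Transverse H t (idxSet i₀ x) U) : BadSet H t x U := by
  have h : ∀ v : {v // v ∈ U}, ∃ a, v.1 ∈ H.pVerts (x a) t := by
    rintro ⟨v, hv⟩
    have := hU hv
    simp only [mem_sdiff, splitVerts, idxSet, mem_biUnion, mem_insert, mem_image, mem_univ, true_and] at this
    obtain ⟨⟨i, hi, hvi⟩, h0⟩ := this
    rcases hi with rfl | ⟨a, rfl⟩
    · exact absurd hvi h0
    · exact ⟨a, hvi⟩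
  choose φ hφ using h
  refine ⟨φ, ?_, hφ⟩
  intro v w hvw
  have h1 := hT (x (φ v)) (by simp [idxSet])
  rw [Finset.card_le_one] at h1
  exact Subtype.ext (h1 v.1 (mem_inter.2 ⟨v.2, hφ v⟩) w.1 (mem_inter.2 ⟨w.2, hvw ▸ hφ w⟩))

lemma Transverse.mono {H : LooseHamCycle k G} {t : ℕ} {I S S' : Finset ℕ}
    (h : Transverse H t I S) (hs : S' ⊆ S) : Transverse H t I S' :=
  fun i hi => (card_le_card (inter_subset_inter_right hs)).trans (h i hi)

lemma suitable_of (H : LooseHamCycle k G) (χ : Finset ℕ → ℕ) (hk : 2 ≤ k) (ε : ℝ) (m t i₀ : ℕ)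
    {L : ℕ} (x : Fin L → Fin (numE G))
    (hm : ((k * (t * (k - 1) + 1) : ℕ) : ℝ) ≤ ε * m / 4)
    (hsp : IsSplitting H t (idxSet i₀ x))
    (h1 : ¬ ∃ U ∈ fam1 G H χ, BadSet H t x U)
    (h2 : ¬ ∃ U ∈ fam2 G χ, BadSet H t x U)
    (h3 : ¬ ∃ U ∈ fam3 G χ, BadSet H t x U) :
    Suitable χ ε m H t (idxSet i₀ x) i₀ := by
  set I := idxSet i₀ x with hI
  refine ⟨?_, ?_, ?_⟩
  · intro S hS hSc hST
    have hidx : ∀ s : {s // s ∈ S}, ∃ i ∈ I, s.1 ∈ H.pVerts i t := by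
      rintro ⟨s, hs⟩
      have := hS hs
      simp only [mem_sdiff, splitVerts, mem_biUnion] at this
      exact this.1
    choose ι hιI hι using hidx
    set W : Finset ℕ := H.pVerts i₀ t ∪ univ.biUnion (fun s => H.pVerts (ι s) t) with hW
    have hWc : W.card ≤ k * (t * (k - 1) + 1) := by
      refine (card_union_le _ _).trans ?_
      have a1 := pVerts_card_le H i₀ t
      have a2 : (univ.biUnion (fun s => H.pVerts (ι s) t)).card ≤ (k - 1) * (t * (k - 1) + 1) := by
        refine card_biUnion_le.trans ?_
        refine (Finset.sum_le_card_nsmul _ _ _ fun s _ => pVerts_card_le H (ι s) t).trans ?_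
        rw [smul_eq_mul, card_univ, Fintype.card_coe, hSc]
      have : k * (t * (k - 1) + 1) = (t * (k - 1) + 1) + (k - 1) * (t * (k - 1) + 1) := by
        obtain ⟨q, rfl⟩ : ∃ q, k = q + 1 := ⟨k - 1, by omega⟩
        simp; ring
      omega
    have hsub : ((G.inducedEdges (splitVerts H t I)).filter
        fun e => S ⊆ e ∧ ∃ f ∈ H.cedges, χ f = χ e) ⊆ W.image (fun w => insert w S) := by
      intro e he
      simp only [mem_filter, HGraph.inducedEdges] at he
      obtain ⟨⟨heG, heV⟩, hSe, hcol⟩ := he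
      have hc : (e \ S).card = 1 := by
        rw [card_sdiff_of_subset hSe, G.edge_card e heG, hSc]; omega
      obtain ⟨w, hw⟩ := card_eq_one.1 hc
      have hwe : w ∈ e ∧ w ∉ S := mem_sdiff.1 (hw ▸ mem_singleton_self w)
      have hee : insert w S = e := by
        rw [← sdiff_union_of_subset hSe, hw]; rfl
      refine mem_image.2 ⟨w, ?_, hee⟩
      by_contra hwW
      simp only [hW, mem_union, mem_biUnion, mem_univ, true_and, not_or, not_exists] at hwW
      apply h1
      refine ⟨e, mem_filter.2 ⟨heG, hcol⟩, badSet_of_transverse H t i₀ x e ?_ ?_⟩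
      · intro v hv
        refine mem_sdiff.2 ⟨heV hv, ?_⟩
        rw [← hee] at hv
        rcases mem_insert.1 hv with rfl | hv
        · exact hwW.1
        · exact (mem_sdiff.1 (hS hv)).2
      · intro i hi
        by_cases hwi : w ∈ H.pVerts i t
        · have : e ∩ H.pVerts i t ⊆ {w} := by
            intro v hv
            obtain ⟨hv1, hv2⟩ := mem_inter.1 hv
            rw [← hee] at hv1
            rcases mem_insert.1 hv1 with rfl | hv1
            · simp
            · exfalso
              have hne : i = ι ⟨v, hv1⟩ := by
                by_contra hne
                exact Finset.disjoint_left.1 (hsp.2 i hi _ (hιI ⟨v, hv1⟩) hne) hv2 (hι ⟨v, hv1⟩)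
              exact hwW.2 ⟨v, hv1⟩ (hne ▸ hwi)
          exact (card_le_card this).trans (by simp)
        · rw [← hee, insert_inter_of_notMem hwi]
          exact hST i hi
    calc _ ≤ ((W.image (fun w => insert w S)).card : ℝ) := by exact_mod_cast card_le_card hsub
      _ ≤ ((k * (t * (k - 1) + 1) : ℕ) : ℝ) := by exact_mod_cast card_image_le.trans hWc
      _ ≤ _ := hm
  · intro X hX hXT e he f hf hχ hc
    simp only [HGraph.inducedEdges, mem_filter] at he hf
    apply h2
    have hs : e ∪ f ⊆ X := union_subset he.2 hf.2
    refine ⟨e ∪ f, ?_, badSet_of_transverse H t i₀ x _ (hs.trans hX) (hXT.mono hs)⟩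
    simp only [fam2, monoPairs, mem_image, mem_filter, mem_product]
    exact ⟨(e, f), ⟨⟨⟨he.1, hf.1⟩, hχ⟩, hc⟩, rfl⟩
  · intro e he f hf hχ hd heT hfT
    by_contra hcon
    simp only [HGraph.inducedEdges, mem_filter] at he hf
    obtain ⟨v, hv, hvp⟩ : ∃ v ∈ f, ∀ i ∈ I, (H.pVerts i t ∩ e).Nonempty → (H.pVerts i t ∩ f).Nonempty →
        v ∈ H.pVerts i t := by
      by_cases hex : ∃ i ∈ I, (H.pVerts i t ∩ e).Nonempty ∧ (H.pVerts i t ∩ f).Nonempty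
      · obtain ⟨i, hi, hie, hif⟩ := hex
        obtain ⟨v, hv⟩ := id hif
        refine ⟨v, (mem_inter.1 hv).2, ?_⟩
        intro i' hi' h1' h2'
        by_cases hii : i = i'
        · exact hii ▸ (mem_inter.1 hv).1
        · exact absurd ⟨i, hi, i', hi', hii, hie, hif, h1', h2'⟩ hcon
      · have : f.Nonempty := by
          rw [← card_pos, G.edge_card f hf.1]; omega
        obtain ⟨v, hv⟩ := this
        exact ⟨v, hv, fun i hi a b => absurd ⟨i, hi, a, b⟩ hex⟩
    apply h3
    refine ⟨e ∪ f.erase v, ?_, badSet_of_transverse H t i₀ x _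
      (union_subset he.2 ((erase_subset _ _).trans hf.2)) ?_⟩
    · simp only [fam3, monoPairs, mem_biUnion, mem_image, mem_filter, mem_product]
      exact ⟨(e, f), ⟨⟨⟨he.1, hf.1⟩, hχ⟩, hd⟩, v, hv, rfl⟩
    · intro i hi
      rw [union_inter_distrib_right]
      by_cases h1' : (H.pVerts i t ∩ e).Nonempty
      · have : f.erase v ∩ H.pVerts i t = ∅ := by
          rw [eq_empty_iff_forall_notMem]
          intro u hu
          obtain ⟨hu1, hu2⟩ := mem_inter.1 hu
          have huf := mem_of_mem_erase hu1
          have hvi := hvp i hi h1' ⟨u, mem_inter.2 ⟨hu2, huf⟩⟩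
          have := card_le_one.1 (hfT i hi) u (mem_inter.2 ⟨huf, hu2⟩) v (mem_inter.2 ⟨hv, hvi⟩)
          exact ne_of_mem_erase hu1 this
        rw [this, union_empty]
        exact heT i hi
      · rw [not_nonempty_iff_eq_empty, inter_comm] at h1'
        rw [h1', empty_union]
        exact (hfT.mono (erase_subset v f)) i hi

/-- the paths are pairwise disjoint -/
def SplitOK (H : LooseHamCycle k G) (t i₀ : ℕ) {L : ℕ} (x : Fin L → Fin (numE G)) : Prop :=
  (∀ a b, a ≠ b → Disjoint (H.pVerts (x a) t) (H.pVerts (x b) t)) ∧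
  ∀ a, Disjoint (H.pVerts i₀ t) (H.pVerts (x a) t)

lemma pVerts_nonempty (H : LooseHamCycle k G) (i t : ℕ) : (H.pVerts i t).Nonempty :=
  ⟨vtx H i 0, (mem_pVerts _ _ _ _).2 ⟨0, by omega, rfl⟩⟩

lemma splitOK_inj (H : LooseHamCycle k G) (t i₀ : ℕ) {L : ℕ} (x : Fin L → Fin (numE G))
    (h : SplitOK H t i₀ x) : Function.Injective x := by
  intro a b hab
  by_contra hne
  have := h.1 a b hne
  rw [hab, disjoint_self_iff_empty] at this
  exact (pVerts_nonempty H _ t).ne_empty this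

lemma splitOK_card (H : LooseHamCycle k G) (t i₀ : ℕ) {L : ℕ} (x : Fin L → Fin (numE G))
    (h : SplitOK H t i₀ x) : (idxSet i₀ x).card = L + 1 := by
  unfold idxSet
  rw [card_insert_of_notMem, card_image_of_injective _
    (fun a b hab => splitOK_inj H t i₀ x h (Fin.ext hab))]
  · simp
  · intro h0
    obtain ⟨a, _, ha⟩ := mem_image.1 h0
    have := h.2 a
    rw [ha, disjoint_self_iff_empty] at this
    exact (pVerts_nonempty H _ t).ne_empty this

lemma splitOK_split (H : LooseHamCycle k G) (t i₀ : ℕ) (hi₀ : i₀ < numE G) {L : ℕ}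
    (x : Fin L → Fin (numE G)) (h : SplitOK H t i₀ x) : IsSplitting H t (idxSet i₀ x) := by
  constructor
  · intro i hi
    simp only [idxSet, mem_insert, mem_image, mem_univ, true_and] at hi
    rcases hi with rfl | ⟨a, rfl⟩
    · exact hi₀
    · exact (x a).2
  · intro i hi i' hi' hne
    simp only [idxSet, mem_insert, mem_image, mem_univ, true_and] at hi hi'
    rcases hi with rfl | ⟨a, rfl⟩
    · rcases hi' with rfl | ⟨b, rfl⟩
      · exact absurd rfl hne
      · exact h.2 b
    · rcases hi' with rfl | ⟨b, rfl⟩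
      · exact (h.2 a).symm
      · exact h.1 a b (fun hab => hne (by rw [hab]))

lemma notSplit_card (H : LooseHamCycle k G) (hk : 2 ≤ k) (hNK : G.verts.card = numE G * (k - 1))
    (hNpos : 0 < numE G) (t i₀ L : ℕ) :
    (univ.filter (fun x : Fin L → Fin (numE G) => ¬ SplitOK H t i₀ x)).card * numE G
      ≤ (L ^ 2 + L) * (t * (k - 1) + 1) ^ 2 * numE G ^ L := by
  set T := t * (k - 1) + 1
  have hA : ∀ a b : Fin L, a ≠ b → (univ.filter (fun x : Fin L → Fin (numE G) =>
      ¬ Disjoint (H.pVerts (x a) t) (H.pVerts (x b) t))).card * numE G ≤ T ^ 2 * numE G ^ L := by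
    intro a b hab
    have hinj : Function.Injective ![a, b] := by
      intro i j hij
      fin_cases i <;> fin_cases j <;> simp_all
    have := coord_card (α := Fin (numE G)) ![a, b] hinj
      (fun y => ¬ Disjoint (H.pVerts (y 0) t) (H.pVerts (y 1) t))
    simp only [Fintype.card_fin] at this
    have hc : (univ.filter (fun y : Fin 2 → Fin (numE G) =>
        ¬ Disjoint (H.pVerts (y 0) t) (H.pVerts (y 1) t))).card ≤ T ^ 2 * numE G := by
      have := Finset.card_le_mul_card_image_of_maps_to (s := (univ.filter (fun y : Fin 2 → Fin (numE G) =>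
        ¬ Disjoint (H.pVerts (y 0) t) (H.pVerts (y 1) t)))) (f := fun y => y 0) (t := univ)
        (fun _ _ => mem_univ _) (T ^ 2) ?_
      · simpa using this
      · intro i _
        refine le_trans ?_ (nondisj_card_le H hk hNK t i)
        refine Finset.card_le_card_of_injOn (fun y => y 1) ?_ ?_
        · intro y hy
          simp only [coe_filter, mem_filter, mem_univ, true_and, Set.mem_ofPred_eq] at hy ⊢
          rw [← hy.2]; exact hy.1
        · intro y hy y' hy' h
          simp only [coe_filter, mem_filter, mem_univ, true_and, Set.mem_ofPred_eq] at hy hy'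
          funext l
          fin_cases l
          · exact hy.2.trans hy'.2.symm
          · exact h
    refine Nat.le_of_mul_le_mul_right ?_ hNpos
    have this2 : (univ.filter (fun x : Fin L → Fin (numE G) =>
      ¬ Disjoint (H.pVerts (x a) t) (H.pVerts (x b) t))).card * numE G ^ 2 =
      (univ.filter (fun y : Fin 2 → Fin (numE G) =>
        ¬ Disjoint (H.pVerts (y 0) t) (H.pVerts (y 1) t))).card * numE G ^ L := by
      convert this <;> rfl
    rw [mul_assoc, ← sq, this2]
    refine (Nat.mul_le_mul_right _ hc).trans (le_of_eq ?_)
    ring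
  have hB : ∀ a : Fin L, (univ.filter (fun x : Fin L → Fin (numE G) =>
      ¬ Disjoint (H.pVerts i₀ t) (H.pVerts (x a) t))).card * numE G ≤ T ^ 2 * numE G ^ L := by
    intro a
    have hinj : Function.Injective (fun _ : Unit => a) := fun _ _ _ => rfl
    have := coord_card (α := Fin (numE G)) (fun _ : Unit => a) hinj
      (fun y => ¬ Disjoint (H.pVerts i₀ t) (H.pVerts (y ()) t))
    simp only [Fintype.card_fin, Fintype.card_unit, pow_one] at this
    have this2 : (univ.filter (fun x : Fin L → Fin (numE G) =>
      ¬ Disjoint (H.pVerts i₀ t) (H.pVerts (x a) t))).card * numE G =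
      (univ.filter (fun y : Unit → Fin (numE G) =>
        ¬ Disjoint (H.pVerts i₀ t) (H.pVerts (y ()) t))).card * numE G ^ L := by
      convert this
    rw [this2]
    refine Nat.mul_le_mul_right _ (le_trans ?_ (nondisj_card_le H hk hNK t i₀))
    refine Finset.card_le_card_of_injOn (fun y => y ()) ?_ ?_
    · intro y hy
      simpa using hy
    · intro y _ y' _ h
      funext l
      exact h
  have hsub : (univ.filter (fun x : Fin L → Fin (numE G) => ¬ SplitOK H t i₀ x)) ⊆
      ((univ.filter (fun p : Fin L × Fin L => p.1 ≠ p.2)).biUnion (fun p =>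
        (univ.filter (fun x : Fin L → Fin (numE G) =>
          ¬ Disjoint (H.pVerts (x p.1) t) (H.pVerts (x p.2) t))))) ∪
      univ.biUnion (fun a => (univ.filter (fun x : Fin L → Fin (numE G) =>
        ¬ Disjoint (H.pVerts i₀ t) (H.pVerts (x a) t)))) := by
    intro x hx
    have hx := (mem_filter.1 hx).2
    simp only [mem_union, mem_biUnion, mem_filter, mem_univ, true_and]
    by_contra hcon
    push Not at hcon
    exact hx ⟨fun a b hab => hcon.1 (a, b) hab, hcon.2⟩
  have h1 := (card_le_card hsub).trans (card_union_le _ _)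
  have h2 := Nat.mul_le_mul_right (numE G) h1
  refine h2.trans ?_
  rw [add_mul, add_mul, add_mul]
  refine Nat.add_le_add ?_ ?_
  · refine (Nat.mul_le_mul_right _ card_biUnion_le).trans ?_
    rw [Finset.sum_mul]
    refine (Finset.sum_le_card_nsmul _ _ (T ^ 2 * numE G ^ L) ?_).trans ?_
    · intro p hp
      exact hA p.1 p.2 (mem_filter.1 hp).2
    · rw [smul_eq_mul, mul_assoc]
      refine Nat.mul_le_mul_right _ ((card_filter_le _ _).trans ?_)
      simp [sq]
  · refine (Nat.mul_le_mul_right _ card_biUnion_le).trans ?_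
    rw [Finset.sum_mul]
    refine (Finset.sum_le_card_nsmul _ _ (T ^ 2 * numE G ^ L) fun a _ => hB a).trans ?_
    rw [smul_eq_mul, mul_assoc]
    simp

end Col

section Deg
variable {k : ℕ} {G : HGraph k}

def EdP (G : HGraph k) {d : ℕ} (T : Finset ℕ) (v : Fin d → ℕ) : Prop :=
  Function.Injective v ∧ Disjoint T (univ.image v) ∧ T ∪ univ.image v ∈ G.edges

def cnt (H : LooseHamCycle k G) (t : ℕ) {L : ℕ} (d : ℕ) (T : Finset ℕ) (B : Finset (Fin L))
    (x : Fin L → Fin (numE G)) : ℕ :=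
  ((univ : Finset ((Fin d → Fin L) × (Fin d → Fin (t * (k - 1))))).filter (fun p =>
    (Function.Injective p.1 ∧ ∀ l, p.1 l ∈ B) ∧
      EdP G T (fun l => vtx H (x (p.1 l)) (p.2 l)))).card

lemma image_eq_of_inj {d : ℕ} (W : Finset ℕ) (hW : W.card = d) (v : Fin d → ℕ)
    (hv : Function.Injective v) (hm : ∀ l, v l ∈ W) : univ.image v = W := by
  apply Finset.eq_of_subset_of_card_le
  · intro z hz
    obtain ⟨l, _, rfl⟩ := mem_image.1 hz
    exact hm l
  · rw [card_image_of_injective _ hv, hW]; simp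

lemma edVec_card (T : Finset ℕ) (d : ℕ) (hT : T.card + d = k) :
    d.factorial * G.degOn T ≤
      ((Fintype.piFinset (fun _ : Fin d => G.verts)).filter (EdP G T)).card := by
  have hcard : ∀ e ∈ G.edges.filter (fun e => T ⊆ e), (e \ T).card = d := by
    intro e he
    obtain ⟨he1, he2⟩ := mem_filter.1 he
    rw [card_sdiff_of_subset he2, G.edge_card e he1]; omega
  have h1 : (G.edges.filter (fun e => T ⊆ e)).biUnion (fun e =>
      (Fintype.piFinset (fun _ : Fin d => e \ T)).filter Function.Injective) ⊆
      ((Fintype.piFinset (fun _ : Fin d => G.verts)).filter (EdP G T)) := by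
    intro v hv
    obtain ⟨e, he, hv⟩ := mem_biUnion.1 hv
    obtain ⟨he1, he2⟩ := mem_filter.1 he
    obtain ⟨hv1, hv2⟩ := mem_filter.1 hv
    have hv1 := Fintype.mem_piFinset.1 hv1
    have him := image_eq_of_inj (e \ T) (hcard e he) v hv2 hv1
    refine mem_filter.2 ⟨Fintype.mem_piFinset.2 fun l => G.edge_sub e he1 (sdiff_subset (hv1 l)), hv2, ?_, ?_⟩
    · rw [him]; exact disjoint_sdiff
    · rw [him, union_sdiff_of_subset he2]; exact he1
  refine le_trans ?_ (card_le_card h1)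
  rw [card_biUnion]
  · rw [sum_congr rfl (fun e he => vec_card d (e \ T) (hcard e he))]
    rw [sum_const, smul_eq_mul, mul_comm]
    exact le_of_eq rfl
  · intro e he e' he' hne
    rw [Function.onFun, Finset.disjoint_left]
    intro v hv hv'
    apply hne
    have h1 := image_eq_of_inj (e \ T) (hcard e he) v (mem_filter.1 hv).2
      (Fintype.mem_piFinset.1 (mem_filter.1 hv).1)
    have h2 := image_eq_of_inj (e' \ T) (hcard e' he') v (mem_filter.1 hv').2
      (Fintype.mem_piFinset.1 (mem_filter.1 hv').1)
    rw [← union_sdiff_of_subset (mem_filter.1 he).2, ← h1, h2,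
      union_sdiff_of_subset (mem_filter.1 he').2]

lemma edPos_card (H : LooseHamCycle k G) (hk : 2 ≤ k) (hNK : G.verts.card = numE G * (k - 1))
    (t : ℕ) (ht : t ≤ numE G) (T : Finset ℕ) (d : ℕ) (hT : T.card + d = k) :
    t ^ d * (d.factorial * G.degOn T) ≤
      ((univ : Finset ((Fin d → Fin (numE G)) × (Fin d → Fin (t * (k - 1))))).filter
        (fun p => EdP G T (fun l => vtx H (p.1 l) (p.2 l)))).card := by
  refine (Nat.mul_le_mul_left _ (edVec_card T d hT)).trans ?_
  rw [mul_comm]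
  refine (Finset.card_nsmul_le_sum _ (fun v =>
    (Fintype.piFinset (fun l => (univ.filter (fun p : Fin (numE G) × Fin (t * (k - 1)) =>
      vtx H p.1 p.2 = v l)))).card) _ ?_).trans ?_
  · intro v hv
    rw [Fintype.card_piFinset]
    have := Finset.prod_le_prod' (s := (univ : Finset (Fin d))) (f := fun _ => t)
      (g := fun l => (univ.filter (fun p : Fin (numE G) × Fin (t * (k - 1)) =>
      vtx H p.1 p.2 = v l)).card) (fun l _ => fiber_ge H hk hNK t ht (v l)
        (Fintype.mem_piFinset.1 (mem_filter.1 hv).1 l))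
    simpa using this
  · rw [← card_sigma]
    refine Finset.card_le_card_of_injOn (fun q => (fun l => (q.2 l).1, fun l => (q.2 l).2)) ?_ ?_
    · rintro ⟨v, w⟩ hq
      obtain ⟨hv, hw⟩ := mem_sigma.1 (mem_coe.1 hq)
      have hw := Fintype.mem_piFinset.1 hw
      refine mem_coe.2 (mem_filter.2 ⟨mem_univ _, ?_⟩)
      have : (fun l => vtx H (w l).1 (w l).2) = v := by
        funext l
        exact (mem_filter.1 (hw l)).2
      show EdP G T (fun l => vtx H (w l).1 (w l).2)
      rw [this]
      exact (mem_filter.1 hv).2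
    · rintro ⟨v, w⟩ hq ⟨v', w'⟩ hq' h
      obtain ⟨hv, hw⟩ := mem_sigma.1 (mem_coe.1 hq)
      obtain ⟨hv', hw'⟩ := mem_sigma.1 (mem_coe.1 hq')
      have hw := Fintype.mem_piFinset.1 hw
      have hw' := Fintype.mem_piFinset.1 hw'
      have hww : w = w' := by
        funext l
        exact Prod.ext (congrFun (congrArg Prod.fst h) l) (congrFun (congrArg Prod.snd h) l)
      subst hww
      have : v = v' := by
        funext l
        exact (mem_filter.1 (hw l)).2.symm.trans (mem_filter.1 (hw' l)).2
      subst this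
      rfl

lemma cnt_mean (H : LooseHamCycle k G) (hk : 2 ≤ k) (hNK : G.verts.card = numE G * (k - 1))
    (t : ℕ) (ht : t ≤ numE G) {L : ℕ} (T : Finset ℕ) (d : ℕ) (hT : T.card + d = k)
    (B : Finset (Fin L)) :
    (B.card + 1 - d) ^ d * (t ^ d * (d.factorial * G.degOn T)) * numE G ^ L ≤
      (∑ x, cnt H t d T B x) * numE G ^ d := by
  have hA : (B.card + 1 - d) ^ d ≤
      ((univ : Finset (Fin d → Fin L)).filter (fun a => Function.Injective a ∧ ∀ l, a l ∈ B)).card := by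
    refine (Nat.pow_sub_le_descFactorial _ _).trans ?_
    have : Fintype.card (Fin d ↪ B) = B.card.descFactorial d := by
      rw [Fintype.card_embedding_eq]; simp
    rw [← this, ← Finset.card_univ]
    refine Finset.card_le_card_of_injOn (fun f l => (f l : Fin L)) ?_ ?_
    · intro f _
      refine mem_coe.2 (mem_filter.2 ⟨mem_univ _, ?_, fun l => (f l).2⟩)
      intro l l' h
      exact f.injective (Subtype.ext h)
    · intro f _ f' _ h
      ext l
      exact congrArg Fin.val (congrFun h l)
  have hc : ∀ x, cnt H t d T B x = ∑ a ∈ (univ : Finset (Fin d → Fin L)).filter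
      (fun a => Function.Injective a ∧ ∀ l, a l ∈ B),
      ((univ : Finset (Fin d → Fin (t * (k - 1)))).filter (fun r =>
        EdP G T (fun l => vtx H (x (a l)) (r l)))).card := by
    intro x
    unfold cnt
    rw [← card_sigma]
    refine Finset.card_bij (fun p _ => ⟨p.1, p.2⟩) ?_ ?_ ?_
    · intro p hp
      obtain ⟨_, h1, h2⟩ := mem_filter.1 hp
      exact mem_sigma.2 ⟨mem_filter.2 ⟨mem_univ _, h1⟩, mem_filter.2 ⟨mem_univ _, h2⟩⟩
    · intro p _ p' _ h
      simp only [Sigma.mk.injEq, heq_eq_eq] at h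
      exact Prod.ext h.1 h.2
    · rintro ⟨a, r⟩ h
      obtain ⟨h1, h2⟩ := mem_sigma.1 h
      exact ⟨(a, r), mem_filter.2 ⟨mem_univ _, (mem_filter.1 h1).2, (mem_filter.1 h2).2⟩, rfl⟩
  simp_rw [hc]
  rw [sum_comm, sum_mul]
  refine le_trans ?_ (Finset.card_nsmul_le_sum _ _
    ((t ^ d * (d.factorial * G.degOn T)) * numE G ^ L) ?_)
  · rw [smul_eq_mul, mul_assoc]
    exact Nat.mul_le_mul_right _ hA
  · intro a ha
    have h := coord_sum (α := Fin (numE G)) a (mem_filter.1 ha).2.1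
      (fun y => ((univ : Finset (Fin d → Fin (t * (k - 1)))).filter (fun r =>
        EdP G T (fun l => vtx H (y l) (r l)))).card)
    simp only [Fintype.card_fin] at h
    have h' : (∑ x : Fin L → Fin (numE G), ((univ : Finset (Fin d → Fin (t * (k - 1)))).filter (fun r =>
        EdP G T (fun l => vtx H (x (a l)) (r l)))).card) * numE G ^ d =
        (∑ y : Fin d → Fin (numE G), ((univ : Finset (Fin d → Fin (t * (k - 1)))).filter (fun r =>
        EdP G T (fun l => vtx H (y l) (r l)))).card) * numE G ^ L := by
      convert h
    rw [h']
    refine Nat.mul_le_mul_right _ ((edPos_card H hk hNK t ht T d hT).trans ?_)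
    rw [← card_sigma]
    refine Finset.card_le_card_of_injOn (fun p => ⟨p.1, p.2⟩) ?_ ?_
    · intro p hp
      exact mem_coe.2 (mem_sigma.2 ⟨mem_univ _, mem_filter.2 ⟨mem_univ _, (mem_filter.1 hp).2⟩⟩)
    · intro p _ p' _ h
      simp only [Sigma.mk.injEq, heq_eq_eq] at h
      exact Prod.ext h.1 h.2

lemma cnt_le_update (H : LooseHamCycle k G) (t : ℕ) {L : ℕ} (T : Finset ℕ) (d : ℕ)
    (B : Finset (Fin L)) (x : Fin L → Fin (numE G)) (b : Fin L) (x' : Fin L → Fin (numE G))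
    (hx : ∀ a, a ≠ b → x a = x' a) :
    cnt H t d T B x ≤ cnt H t d T B x' + d * (L ^ (d - 1) * (t * (k - 1)) ^ d) := by
  have hbad : ((univ : Finset ((Fin d → Fin L) × (Fin d → Fin (t * (k - 1))))).filter (fun p =>
      ∃ l, p.1 l = b)).card ≤ d * (L ^ (d - 1) * (t * (k - 1)) ^ d) := by
    have : ((univ : Finset ((Fin d → Fin L) × (Fin d → Fin (t * (k - 1))))).filter (fun p =>
      ∃ l, p.1 l = b)) ⊆ (univ : Finset (Fin d)).biUnion (fun l =>
        (Fintype.piFinset (fun l' => if l' = l then {b} else (univ : Finset (Fin L)))) ×ˢ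
          (univ : Finset (Fin d → Fin (t * (k - 1))))) := by
      intro p hp
      obtain ⟨l, hl⟩ := (mem_filter.1 hp).2
      refine mem_biUnion.2 ⟨l, mem_univ _, mem_product.2 ⟨Fintype.mem_piFinset.2 ?_, mem_univ _⟩⟩
      intro l'
      split_ifs with h
      · rw [h]; simpa using hl
      · simp
    refine (card_le_card this).trans (card_biUnion_le.trans ?_)
    refine (Finset.sum_le_card_nsmul _ _ (L ^ (d - 1) * (t * (k - 1)) ^ d) ?_).trans (by simp)
    intro l _
    rw [card_product, Fintype.card_piFinset]
    apply le_of_eq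
    congr 1
    · rw [← Finset.mul_prod_erase _ _ (mem_univ l)]
      rw [prod_congr rfl (g := fun _ => L)]
      · simp
      · intro l' hl'
        rw [if_neg (ne_of_mem_erase hl')]; simp
    · simp
  refine le_trans ?_ (Nat.add_le_add_left hbad _)
  unfold cnt
  refine le_trans (card_le_card ?_) (card_union_le _ _)
  intro p hp
  obtain ⟨_, h1, h2⟩ := mem_filter.1 hp
  by_cases hb : ∃ l, p.1 l = b
  · exact mem_union_right _ (mem_filter.2 ⟨mem_univ _, hb⟩)
  · refine mem_union_left _ (mem_filter.2 ⟨mem_univ _, h1, ?_⟩)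
    push Not at hb
    have : (fun l => vtx H (x' (p.1 l)) (p.2 l)) = (fun l => vtx H (x (p.1 l)) (p.2 l)) := by
      funext l
      rw [hx _ (hb l)]
    rw [this]; exact h2

lemma cnt_le_deg (H : LooseHamCycle k G) (t : ℕ) (hRn : t * (k - 1) ≤ G.verts.card)
    {L : ℕ} (T : Finset ℕ) (d : ℕ) (hT : T.card + d = k) (i₀ : ℕ)
    (B : Finset (Fin L)) (x : Fin L → Fin (numE G)) (hx : SplitOK H t i₀ x) (U : Finset ℕ)
    (hTU : T ⊆ U) (hU : ∀ a, H.pVerts (x a) t ⊆ U) :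
    cnt H t d T B x ≤ d.factorial * ((G.inducedEdges U).filter (fun e => T ⊆ e)).card := by
  unfold cnt
  have hmem : ∀ a (r : Fin (t * (k - 1))), vtx H (x a) r ∈ H.pVerts (x a) t := fun a r =>
    (mem_pVerts _ _ _ _).2 ⟨r, by omega, rfl⟩
  refine Finset.card_le_mul_card_image_of_maps_to
    (f := fun p => T ∪ univ.image (fun l => vtx H (x (p.1 l)) (p.2 l))) ?_ _ ?_
  · intro p hp
    obtain ⟨_, h1, h2⟩ := mem_filter.1 hp
    refine mem_filter.2 ⟨mem_filter.2 ⟨h2.2.2, union_subset hTU ?_⟩, subset_union_left⟩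
    intro z hz
    obtain ⟨l, _, rfl⟩ := mem_image.1 hz
    exact hU _ (hmem _ _)
  · intro e he
    obtain ⟨he1, he2⟩ := mem_filter.1 he
    have hcard : (e \ T).card = d := by
      rw [card_sdiff_of_subset he2, G.edge_card e (mem_filter.1 he1).1]; omega
    rw [← vec_card d (e \ T) hcard]
    refine Finset.card_le_card_of_injOn (fun p l => vtx H (x (p.1 l)) (p.2 l)) ?_ ?_
    · intro p hp
      obtain ⟨hp1, hp2⟩ := mem_filter.1 (mem_coe.1 hp)
      obtain ⟨_, h1, h2⟩ := mem_filter.1 hp1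
      refine mem_coe.2 (mem_filter.2 ⟨Fintype.mem_piFinset.2 fun l => ?_, h2.1⟩)
      have hz : vtx H (x (p.1 l)) (p.2 l) ∈ univ.image (fun l => vtx H (x (p.1 l)) (p.2 l)) :=
        mem_image_of_mem _ (mem_univ l)
      refine mem_sdiff.2 ⟨?_, fun hT' => (Finset.disjoint_left.1 h2.2.1) hT' hz⟩
      rw [← hp2]
      exact mem_union_right _ hz
    · intro p _ p' _ h
      have hl : ∀ l, p.1 l = p'.1 l ∧ p.2 l = p'.2 l := by
        intro l
        have hl : vtx H (x (p.1 l)) (p.2 l) = vtx H (x (p'.1 l)) (p'.2 l) := congrFun h l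
        have h1 : p.1 l = p'.1 l := by
          by_contra hne
          have h3 := hmem (p.1 l) (p.2 l)
          have h4 := hmem (p'.1 l) (p'.2 l)
          rw [← hl] at h4
          exact (Finset.disjoint_left.1 (hx.1 _ _ hne)) h3 h4
        refine ⟨h1, ?_⟩
        rw [h1] at hl
        exact Fin.ext (vtx_inj_right H ((p.2 l).2.trans_le hRn) ((p'.2 l).2.trans_le hRn) hl)
      exact Prod.ext (funext fun l => (hl l).1) (funext fun l => (hl l).2)

end Deg

section Tau
variable {k : ℕ} {G : HGraph k}

def tauV (H : LooseHamCycle k G) (i₀ : ℕ) {L Tl : ℕ} (x : Fin L → Fin (numE G))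
    (q : Option (Fin L) × Fin Tl) : ℕ := vtx H (q.1.elim i₀ (fun a => (x a : ℕ))) q.2

def tauT (H : LooseHamCycle k G) (i₀ : ℕ) {L Tl j : ℕ} (τ : Fin j → Option (Fin L) × Fin Tl)
    (x : Fin L → Fin (numE G)) : Finset ℕ := univ.image (fun l => tauV H i₀ x (τ l))

def tauA {L Tl j : ℕ} (τ : Fin j → Option (Fin L) × Fin Tl) : Finset (Fin L) :=
  (univ.image (fun l => (τ l).1)).eraseNone

lemma swap_card_fin {L : ℕ} {α : Type*} [Fintype α] [Nonempty α]
    (A : Finset (Fin L)) (Q : (Fin L → α) → (Fin L → α) → Prop)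
    (hQ : ∀ x y, Q x y ↔ Q (A.piecewise y x) (A.piecewise y x)) (η : ℝ)
    (h : ∀ y, ((univ.filter (fun x => Q x y)).card : ℝ) ≤ η) :
    ((univ.filter (fun x => Q x x)).card : ℝ) ≤ η := by
  have := swap_card A Q (by intro x y; convert hQ x y) η (by intro y; convert h y)
  convert this

lemma tauA_card {L Tl j : ℕ} (τ : Fin j → Option (Fin L) × Fin Tl) : (tauA τ).card ≤ j := by
  unfold tauA
  refine (Finset.card_eraseNone_le _).trans (card_image_le.trans (by simp))

lemma tauT_congr (H : LooseHamCycle k G) (i₀ : ℕ) {L Tl j : ℕ} (τ : Fin j → Option (Fin L) × Fin Tl)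
    (x y : Fin L → Fin (numE G)) (h : ∀ a ∈ tauA τ, x a = y a) : tauT H i₀ τ x = tauT H i₀ τ y := by
  unfold tauT
  congr 1
  funext l
  unfold tauV
  rcases hq : (τ l).1 with _ | a
  · rfl
  · have : a ∈ tauA τ := by
      unfold tauA
      rw [mem_eraseNone, ← hq]
      exact mem_image_of_mem _ (mem_univ l)
    simp [h a this]

lemma cnt_congr (H : LooseHamCycle k G) (t : ℕ) {L : ℕ} (d : ℕ) (T : Finset ℕ) (B : Finset (Fin L))
    (x y : Fin L → Fin (numE G)) (h : ∀ a ∈ B, x a = y a) : cnt H t d T B x = cnt H t d T B y := by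
  unfold cnt
  congr 1
  apply filter_congr
  intro p _
  refine and_congr_right fun hp => ?_
  have : (fun l => vtx H (x (p.1 l)) (p.2 l)) = (fun l => vtx H (y (p.1 l)) (p.2 l)) := by
    funext l
    rw [h _ (hp.2 l)]
  rw [this]

lemma tauFail (H : LooseHamCycle k G) (hk : 2 ≤ k) (hNK : G.verts.card = numE G * (k - 1))
    (t : ℕ) (ht : t ≤ numE G) (ht0 : 0 < t) {L : ℕ} (hL : 0 < L) (i₀ j d : ℕ) (hd : 0 < d)
    (hjd : j + d = k) {Tl : ℕ} (τ : Fin j → Option (Fin L) × Fin Tl) (D thr a : ℝ)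
    (hD : G.MinDegGe j D) (ha : 0 ≤ a)
    (hmean : (thr + a) * (numE G : ℝ) ^ d ≤
      ((L - j + 1 - d : ℕ) : ℝ) ^ d * ((t : ℝ) ^ d * (d.factorial * D))) :
    ((univ.filter (fun x : Fin L → Fin (numE G) => (tauT H i₀ τ x).card = j ∧
      (cnt H t d (tauT H i₀ τ x) (tauA τ)ᶜ x : ℝ) ≤ thr)).card : ℝ) ≤
      (numE G : ℝ) ^ L * Real.exp (-(a ^ 2 / (2 * L *
        ((d * (L ^ (d - 1) * (t * (k - 1)) ^ d) : ℕ) : ℝ) ^ 2))) := by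
  have hN : 0 < numE G := by omega
  have : Nonempty (Fin (numE G)) := ⟨⟨0, hN⟩⟩
  have hNr : (0:ℝ) < numE G := by exact_mod_cast hN
  have hn : 0 < G.verts.card := by rw [hNK]; exact Nat.mul_pos hN (by omega)
  have key := swap_card_fin (tauA τ) (fun x y => (tauT H i₀ τ y).card = j ∧
      (cnt H t d (tauT H i₀ τ y) (tauA τ)ᶜ x : ℝ) ≤ thr) ?_ ((numE G : ℝ) ^ L * Real.exp (-(a ^ 2 / (2 * L *
        ((d * (L ^ (d - 1) * (t * (k - 1)) ^ d) : ℕ) : ℝ) ^ 2)))) ?_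
  · convert key
  · intro x y
    have h1 : tauT H i₀ τ ((tauA τ).piecewise y x) = tauT H i₀ τ y :=
      tauT_congr _ _ _ _ _ fun a ha => piecewise_eq_of_mem _ _ _ ha
    have h2 : ∀ T, cnt H t d T (tauA τ)ᶜ ((tauA τ).piecewise y x) = cnt H t d T (tauA τ)ᶜ x :=
      fun T => cnt_congr _ _ _ _ _ _ _ fun a ha => piecewise_eq_of_notMem _ _ _ (mem_compl.1 ha)
    rw [h1, h2]
  · intro y
    by_cases hc : (tauT H i₀ τ y).card = j
    swap
    · simp only [hc, false_and, filter_false, card_empty]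
      simp only [Nat.cast_zero]
      positivity
    simp only [hc, true_and]
    have hsub : tauT H i₀ τ y ⊆ G.verts := by
      intro z hz
      obtain ⟨l, _, rfl⟩ := mem_image.1 hz
      exact vtx_mem H hn _ _
    have hdeg := hD _ hsub hc
    have := mcdiarmid (α := Fin (numE G)) L hL
      (((d * (L ^ (d - 1) * (t * (k - 1)) ^ d) : ℕ) : ℝ)) ?_
      (fun x => (cnt H t d (tauT H i₀ τ y) (tauA τ)ᶜ x : ℝ)) thr a ha ?_ ?_
    · simpa using this
    · have hk1 : 0 < k - 1 := by omega
      have : 0 < d * (L ^ (d - 1) * (t * (k - 1)) ^ d) := by positivity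
      exact_mod_cast this
    · intro x b z
      have h1 := cnt_le_update H t (tauT H i₀ τ y) d (tauA τ)ᶜ x b (Function.update x b z)
        (fun a ha => by rw [Function.update_of_ne ha])
      have h2 := cnt_le_update H t (tauT H i₀ τ y) d (tauA τ)ᶜ (Function.update x b z) b x
        (fun a ha => by rw [Function.update_of_ne ha])
      rw [abs_le]
      constructor
      · have : ((cnt H t d (tauT H i₀ τ y) (tauA τ)ᶜ (Function.update x b z) : ℕ) : ℝ) ≤ _ :=
          Nat.cast_le.2 h2
        rw [Nat.cast_add] at this
        linarith
      · have : ((cnt H t d (tauT H i₀ τ y) (tauA τ)ᶜ x : ℕ) : ℝ) ≤ _ :=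
          Nat.cast_le.2 h1
        rw [Nat.cast_add] at this
        linarith
    · have hm := cnt_mean H hk hNK t ht (tauT H i₀ τ y) d (by omega) (tauA τ)ᶜ
      have hB : L - j + 1 - d ≤ ((tauA τ)ᶜ).card + 1 - d := by
        rw [card_compl, Fintype.card_fin]
        have := tauA_card τ
        omega
      have hm2 : (L - j + 1 - d) ^ d * (t ^ d * (d.factorial * G.degOn (tauT H i₀ τ y))) * numE G ^ L ≤
        (∑ x, cnt H t d (tauT H i₀ τ y) (tauA τ)ᶜ x) * numE G ^ d :=
        le_trans (Nat.mul_le_mul_right _ (Nat.mul_le_mul_right _ (Nat.pow_le_pow_left hB _))) hm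
      have hm3 : (((L - j + 1 - d : ℕ) : ℝ)) ^ d * ((t:ℝ) ^ d * (d.factorial * (G.degOn (tauT H i₀ τ y) : ℝ)))
          * (numE G : ℝ) ^ L ≤
        (∑ x, (cnt H t d (tauT H i₀ τ y) (tauA τ)ᶜ x : ℝ)) * (numE G : ℝ) ^ d := by
        exact_mod_cast hm2
      have h4 : ((L - j + 1 - d : ℕ) : ℝ) ^ d * ((t : ℝ) ^ d * (d.factorial * D)) ≤
        (((L - j + 1 - d : ℕ) : ℝ)) ^ d * ((t:ℝ) ^ d * (d.factorial * (G.degOn (tauT H i₀ τ y) : ℝ))) := by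
        gcongr
      rw [Fintype.card_fin]
      have hNd : (0:ℝ) < (numE G : ℝ) ^ d := by positivity
      refine le_of_mul_le_mul_right ?_ hNd
      refine le_trans ?_ hm3
      calc (numE G : ℝ) ^ L * (thr + a) * (numE G : ℝ) ^ d
          = ((thr + a) * (numE G : ℝ) ^ d) * (numE G : ℝ) ^ L := by ring
        _ ≤ _ := mul_le_mul_of_nonneg_right (hmean.trans h4) (by positivity)

lemma degFail (H : LooseHamCycle k G) (hk : 2 ≤ k) (hNK : G.verts.card = numE G * (k - 1))
    (t : ℕ) (ht : t ≤ numE G) (ht0 : 0 < t) {L : ℕ} (hL : 0 < L) (i₀ j d : ℕ) (hd : 0 < d)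
    (hjd : j + d = k) (D D' a : ℝ)
    (hD : G.MinDegGe j D) (ha : 0 ≤ a)
    (hmean : (d.factorial * D' + a) * (numE G : ℝ) ^ d ≤
      ((L - j + 1 - d : ℕ) : ℝ) ^ d * ((t : ℝ) ^ d * (d.factorial * D))) :
    ((univ.filter (fun x : Fin L → Fin (numE G) => SplitOK H t i₀ x ∧
      ¬ G.MinDegOnGe j (splitVerts H t (idxSet i₀ x)) D')).card : ℝ) ≤
      (((L + 1) * (t * (k - 1) + 1) : ℕ) : ℝ) ^ j * ((numE G : ℝ) ^ L * Real.exp (-(a ^ 2 / (2 * L *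
        ((d * (L ^ (d - 1) * (t * (k - 1)) ^ d) : ℕ) : ℝ) ^ 2)))) := by
  have hsub : (univ.filter (fun x : Fin L → Fin (numE G) => SplitOK H t i₀ x ∧
      ¬ G.MinDegOnGe j (splitVerts H t (idxSet i₀ x)) D')) ⊆
      (univ : Finset (Fin j → Option (Fin L) × Fin (t * (k - 1) + 1))).biUnion (fun τ =>
        univ.filter (fun x : Fin L → Fin (numE G) => (tauT H i₀ τ x).card = j ∧
          (cnt H t d (tauT H i₀ τ x) (tauA τ)ᶜ x : ℝ) ≤ d.factorial * D')) := by
    intro x hx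
    obtain ⟨_, hx1, hx2⟩ := mem_filter.1 hx
    unfold HGraph.MinDegOnGe at hx2
    push Not at hx2
    obtain ⟨T, hTU, hTj, hlt⟩ := hx2
    have hq : ∀ v ∈ T, ∃ q : Option (Fin L) × Fin (t * (k - 1) + 1), tauV H i₀ x q = v := by
      intro v hv
      obtain ⟨i, hi, hv⟩ := mem_biUnion.1 (hTU hv)
      obtain ⟨r, hr, hv⟩ := (mem_pVerts _ _ _ _).1 hv
      rcases mem_insert.1 hi with rfl | hi
      · exact ⟨(none, ⟨r, hr⟩), hv⟩
      · obtain ⟨a, _, rfl⟩ := mem_image.1 hi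
        exact ⟨(some a, ⟨r, hr⟩), hv⟩
    choose! q hq using hq
    let em := (T.equivFinOfCardEq hTj).symm
    have hTT : tauT H i₀ (fun l => q (em l)) x = T := by
      unfold tauT
      ext v
      constructor
      · intro hv
        obtain ⟨l, _, rfl⟩ := mem_image.1 hv
        rw [hq _ (em l).2]
        exact (em l).2
      · intro hv
        refine mem_image.2 ⟨em.symm ⟨v, hv⟩, mem_univ _, ?_⟩
        simp [hq v hv]
    refine mem_biUnion.2 ⟨fun l => q (em l), mem_univ _, mem_filter.2 ⟨mem_univ _, ?_, ?_⟩⟩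
    · rw [hTT, hTj]
    · rw [hTT]
      have h := cnt_le_deg H t (by rw [hNK]; exact Nat.mul_le_mul_right _ ht) T d (by omega) i₀
        (tauA (fun l => q (em l)))ᶜ x hx1 (splitVerts H t (idxSet i₀ x)) hTU ?_
      · refine le_trans (Nat.cast_le.2 h) ?_
        rw [Nat.cast_mul]
        exact mul_le_mul_of_nonneg_left hlt.le (by positivity)
      · intro a z hz
        exact mem_biUnion.2 ⟨x a, mem_insert_of_mem (mem_image_of_mem _ (mem_univ a)), hz⟩
  refine le_trans (Nat.cast_le.2 ((card_le_card hsub).trans card_biUnion_le)) ?_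
  rw [Nat.cast_sum]
  refine le_trans (Finset.sum_le_card_nsmul _ _ _ (fun τ _ =>
    tauFail H hk hNK t ht ht0 hL i₀ j d hd hjd τ D (d.factorial * D') a hD ha hmean)) ?_
  rw [nsmul_eq_mul]
  apply le_of_eq
  congr 1
  simp

end Tau

lemma pow_exp_small (α : ℝ) (hα : 0 < α) (q : ℕ) :
    ∃ s₀ : ℝ, ∀ s : ℝ, s₀ ≤ s → s ^ q * Real.exp (-(α * s)) ≤ 1 / 8 := by
  have h1 := (Real.tendsto_pow_mul_exp_neg_atTop_nhds_zero q).comp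
    (Filter.tendsto_id.const_mul_atTop hα)
  have h2 := h1.const_mul ((α ^ q)⁻¹)
  rw [mul_zero] at h2
  have h3 := h2.eventually (ge_mem_nhds (by norm_num : (0:ℝ) < 1 / 8))
  obtain ⟨s₀, hs⟩ := Filter.eventually_atTop.1 h3
  refine ⟨s₀, fun s h => ?_⟩
  have := hs s h
  simp only [Function.comp, id] at this
  rw [mul_pow] at this
  have hq : α ^ q ≠ 0 := by positivity
  calc s ^ q * Real.exp (-(α * s)) = (α ^ q)⁻¹ * (α ^ q * s ^ q * Real.exp (-(α * s))) := by
        field_simp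
    _ ≤ 1 / 8 := this

lemma params (j k d : ℕ) (hjd : j + d = k) (hk : 2 ≤ k) (hd : 0 < d) (ε δ : ℝ) (hε : 0 < ε) (hδ : 0 ≤ δ) :
    ∃ t : ℕ, 0 < t ∧ 37 ≤ mOf k t ∧ k + 1 ≤ mOf k t ∧
      ((k * (t * (k - 1) + 1) : ℕ) : ℝ) ≤ ε * (mOf k t : ℝ) / 4 ∧
      (δ + 7 * ε / 8) * (MOf k t : ℝ) ^ d ≤
        ((mOf k t - k : ℕ) : ℝ) ^ d * ((t * (k - 1) : ℕ) : ℝ) ^ d * (δ + ε) ∧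
      (MOf k t : ℝ) ^ j * Real.exp (-((d.factorial * (ε / 8) * (MOf k t : ℝ) ^ d) ^ 2 /
        (2 * (mOf k t - 1 : ℕ) * ((d * ((mOf k t - 1) ^ (d - 1) * (t * (k - 1)) ^ d) : ℕ) : ℝ) ^ 2)))
        ≤ 1 / 8 := by
  obtain ⟨s₀, hs₀⟩ := pow_exp_small (ε ^ 2 / (128 * d ^ 2)) (by positivity) (2 * j)
  have hlim : Filter.Tendsto (fun t : ℕ => (1 - (k:ℝ) / (t:ℝ)) ^ d * (1 - 1 / (t:ℝ)) ^ d * (δ + ε))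
      Filter.atTop (nhds ((1 - 0) ^ d * (1 - 0) ^ d * (δ + ε))) := by
    have h1 := tendsto_const_div_atTop_nhds_zero_nat (k:ℝ)
    have h2 := tendsto_const_div_atTop_nhds_zero_nat (1:ℝ)
    exact (((h1.const_sub 1).pow d).mul ((h2.const_sub 1).pow d)).mul_const _
  have hev := hlim.eventually (le_mem_nhds (a := δ + 7 * ε / 8) (by norm_num; linarith))
  obtain ⟨t₁, ht₁⟩ := Filter.eventually_atTop.1 hev
  obtain ⟨t₂, ht₂⟩ := exists_nat_ge (4 * k / ε)
  obtain ⟨t₃, ht₃⟩ := exists_nat_ge s₀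
  set t := t₁ + t₂ + t₃ + 37 + k + 1 with htdef
  have ht0 : 0 < t := by omega
  have hTt : t + 1 ≤ TOf k t := by
    unfold TOf
    have : t * 1 ≤ t * (k - 1) := Nat.mul_le_mul_left _ (by omega)
    omega
  have hmt : t ≤ mtOf k t := by
    unfold mtOf
    exact Nat.le_self_pow (by omega) t
  have hTm : TOf k t * t ≤ mOf k t := Nat.mul_le_mul_left _ hmt
  have hTm' : TOf k t ≤ mOf k t := le_trans (Nat.le_mul_of_pos_right _ ht0) hTm
  have htm : t ≤ mOf k t := by omega
  have hR : t * (k - 1) = TOf k t - 1 := by unfold TOf; omega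
  have hR' : t * (k - 1) + 1 = TOf k t := rfl
  have htr : (0:ℝ) < t := by exact_mod_cast ht0
  have hm0 : (0:ℝ) < mOf k t := by exact_mod_cast (by omega : 0 < mOf k t)
  have hT0 : (0:ℝ) < TOf k t := by exact_mod_cast (by omega : 0 < TOf k t)
  have hM : (MOf k t : ℝ) = TOf k t * mOf k t := by unfold MOf; push_cast; rfl
  refine ⟨t, ht0, by omega, by omega, ?_, ?_, ?_⟩
  · rw [hR']
    have h1 : (4 * k / ε : ℝ) ≤ t := ht₂.trans (by exact_mod_cast (by omega : t₂ ≤ t))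
    rw [div_le_iff₀ hε] at h1
    have h2 : (TOf k t : ℝ) * t ≤ mOf k t := by exact_mod_cast hTm
    push_cast
    calc (k:ℝ) * TOf k t = (4 * k) * TOf k t / 4 := by ring
      _ ≤ (t * ε) * TOf k t / 4 := by gcongr
      _ = ε * (TOf k t * t) / 4 := by ring
      _ ≤ _ := by gcongr
  · have h1 := ht₁ t (by omega)
    have hkt : (k:ℝ) ≤ t := by exact_mod_cast (by omega : k ≤ t)
    have e1 : (1 - (k:ℝ) / t) * mOf k t ≤ ((mOf k t - k : ℕ) : ℝ) := by
      rw [Nat.cast_sub (by omega)]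
      have : (t:ℝ) ≤ mOf k t := by exact_mod_cast htm
      have : (k:ℝ) ≤ k / t * mOf k t := by
        rw [div_mul_eq_mul_div, le_div_iff₀ htr]
        gcongr
      linarith
    have e2 : (1 - 1 / (t:ℝ)) * TOf k t ≤ ((t * (k - 1) : ℕ) : ℝ) := by
      rw [hR, Nat.cast_sub (by omega)]
      have : (t:ℝ) ≤ TOf k t := by exact_mod_cast (by omega : t ≤ TOf k t)
      have : (1:ℝ) ≤ 1 / t * TOf k t := by
        rw [div_mul_eq_mul_div, le_div_iff₀ htr]
        linarith
      push_cast
      linarith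
    have p1 : 0 ≤ 1 - (k:ℝ) / t := by
      rw [sub_nonneg, div_le_one htr]; exact hkt
    have p2 : 0 ≤ 1 - 1 / (t:ℝ) := by
      rw [sub_nonneg, div_le_one htr]; exact_mod_cast ht0
    rw [hM]
    calc (δ + 7 * ε / 8) * ((TOf k t : ℝ) * mOf k t) ^ d
        ≤ ((1 - (k:ℝ) / (t:ℝ)) ^ d * (1 - 1 / (t:ℝ)) ^ d * (δ + ε)) * ((TOf k t : ℝ) * mOf k t) ^ d := by
          gcongr
      _ = ((1 - (k:ℝ) / t) * mOf k t) ^ d * ((1 - 1 / (t:ℝ)) * TOf k t) ^ d * (δ + ε) := by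
          rw [mul_pow, mul_pow, mul_pow]; ring
      _ ≤ _ := by gcongr
  · have hs := hs₀ (mOf k t) (ht₃.trans (by exact_mod_cast (by omega : t₃ ≤ mOf k t)))
    refine le_trans ?_ hs
    have hc : ((d * ((mOf k t - 1) ^ (d - 1) * (t * (k - 1)) ^ d) : ℕ) : ℝ) ≤
        d * ((mOf k t : ℝ) ^ (d - 1) * (TOf k t : ℝ) ^ d) := by
      rw [hR]
      have : d * ((mOf k t - 1) ^ (d - 1) * (TOf k t - 1) ^ d) ≤
        d * (mOf k t ^ (d - 1) * TOf k t ^ d) := by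
        gcongr <;> omega
      exact_mod_cast this
    have hc0 : 0 < ((d * ((mOf k t - 1) ^ (d - 1) * (t * (k - 1)) ^ d) : ℕ) : ℝ) := by
      have h1 : 0 < mOf k t - 1 := by omega
      have h2 : 0 < k - 1 := by omega
      have : 0 < d * ((mOf k t - 1) ^ (d - 1) * (t * (k - 1)) ^ d) := by positivity
      exact_mod_cast this
    set c := ((d * ((mOf k t - 1) ^ (d - 1) * (t * (k - 1)) ^ d) : ℕ) : ℝ)
    have hL : ((mOf k t - 1 : ℕ) : ℝ) ≤ mOf k t := by exact_mod_cast Nat.sub_le _ _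
    have hL0 : (0:ℝ) < ((mOf k t - 1 : ℕ) : ℝ) := by exact_mod_cast (by omega : 0 < mOf k t - 1)
    have hf : (1:ℝ) ≤ d.factorial := by exact_mod_cast Nat.factorial_pos d
    have hd0 : (0:ℝ) < d := by exact_mod_cast hd
    have hexp : ε ^ 2 / (128 * d ^ 2) * mOf k t ≤
        (d.factorial * (ε / 8) * (MOf k t : ℝ) ^ d) ^ 2 / (2 * (mOf k t - 1 : ℕ) * c ^ 2) := by
      rw [le_div_iff₀ (by positivity)]
      calc ε ^ 2 / (128 * d ^ 2) * mOf k t * (2 * (mOf k t - 1 : ℕ) * c ^ 2)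
          ≤ ε ^ 2 / (128 * d ^ 2) * mOf k t * (2 * mOf k t *
              (d * ((mOf k t : ℝ) ^ (d - 1) * (TOf k t : ℝ) ^ d)) ^ 2) := by gcongr
        _ = ((ε / 8) * ((mOf k t : ℝ) * (mOf k t : ℝ) ^ (d - 1) * (TOf k t : ℝ) ^ d)) ^ 2 := by
            field_simp
            ring
        _ = (1 * (ε / 8) * (MOf k t : ℝ) ^ d) ^ 2 := by
            rw [mul_pow_sub_one hd.ne', hM, mul_pow]; ring
        _ ≤ _ := by gcongr
    have hMm : (MOf k t : ℝ) ≤ (mOf k t : ℝ) ^ 2 := by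
      rw [hM, sq]
      have : (TOf k t : ℝ) ≤ mOf k t := by exact_mod_cast hTm'
      gcongr
    rw [pow_mul]
    gcongr

/-- Lemma: a random splitting is suitable with probability at least `1/m`. -/
theorem random_splitting_suitable (j k : ℕ) (hj : 1 ≤ j) (hjk : j < k)
    (ε : ℝ) (hε : 0 < ε) :
    ∃ (t : ℕ) (γ μ : ℝ) (n₀ : ℕ), 0 < t ∧ 0 < γ ∧ 0 < μ ∧
      ∀ n : ℕ, n₀ ≤ n → (k - 1) ∣ n →
        ∀ G : HGraph k, G.verts.card = n →
          G.MinDegGe j ((looseHamThreshold j k + ε) * (n : ℝ) ^ (k - j)) →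
          ∀ χ : Finset ℕ → ℕ, GloballyBounded G χ (μ * (n : ℝ) ^ (k - 1)) →
            ∀ H : LooseHamCycle k G, ∀ i₀ < numE G,
              (1 : ℝ) / (mOf k t : ℝ) ≤
                probOver (numE G) ((((mOf k t - 1) * (k - 1) : ℕ) : ℝ) / (n : ℝ))
                  (fun S =>
                    IsSplitting H t (insert i₀ S) ∧ (insert i₀ S).card = mOf k t ∧
                    Suitable χ ε (mOf k t) H t (insert i₀ S) i₀ ∧
                    G.MinDegOnGe j (splitVerts H t (insert i₀ S))
                      ((looseHamThreshold j k + 3 * ε / 4) * (MOf k t : ℝ) ^ (k - j))) := by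
  have hδ : 0 ≤ looseHamThreshold j k := Real.sInf_nonneg fun x hx => hx.1
  set δ := looseHamThreshold j k with hδdef
  have hk : 2 ≤ k := by omega
  have hk1 : 0 < k - 1 := by omega
  obtain ⟨t, ht0, hm37, hmk, hP2, hP3, hP4⟩ :=
    params j k (k - j) (by omega) hk (by omega) ε δ hε hδ
  set d := k - j with hd
  set m := mOf k t with hm
  have hL1 : m - 1 + 1 = m := by omega
  set L := m - 1 with hL
  set Q : ℕ := (k - 1) * (L * (t * (k - 1) + 1)) with hQ
  have hQ1 : 1 ≤ Q := Nat.mul_pos hk1 (Nat.mul_pos (by omega) (by omega))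
  have hQr : (1:ℝ) ≤ Q := by exact_mod_cast hQ1
  have hkr : (1:ℝ) ≤ k := by exact_mod_cast (by omega : 1 ≤ k)
  set W : ℕ := (L ^ 2 + L) * (t * (k - 1) + 1) ^ 2 with hW
  set μ : ℝ := 1 / (24 * k * (Q:ℝ) ^ (2 * k)) with hμ
  have hμ0 : 0 < μ := by positivity
  refine ⟨t, 1, μ, (k - 1) * (L + 1 + t + 8 * W), ht0, one_pos, hμ0, ?_⟩
  rintro n hn0 hdvd G rfl hdeg χ hχ H i₀ hi₀
  have hNK : G.verts.card = numE G * (k - 1) := (Nat.div_mul_cancel hdvd).symm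
  have hNbig : L + 1 + t + 8 * W ≤ numE G := by
    refine Nat.le_of_mul_le_mul_left ?_ hk1
    rw [mul_comm (k - 1) (numE G), ← hNK]; exact hn0
  have hN0 : 0 < numE G := by omega
  have hNr : (0:ℝ) < numE G := by exact_mod_cast hN0
  have hNL : (0:ℝ) < (numE G : ℝ) ^ L := by positivity
  have hp : (((L * (k - 1) : ℕ) : ℝ) / (G.verts.card : ℝ)) = (L:ℝ) / numE G := by
    rw [hNK]
    push_cast
    have : (((k - 1 : ℕ)) : ℝ) ≠ 0 := by exact_mod_cast hk1.ne'
    rw [mul_div_mul_right _ _ this]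
  rw [hp]
  have hLN : L < numE G := by omega
  have hp1 : (L:ℝ) / numE G ≤ 1 := by
    rw [div_le_one hNr]; exact_mod_cast hLN.le
  refine le_trans ?_ (probOver_ge (numE G) L _ (by positivity) hp1 _)
  -- bad events
  have b0 : ((univ.filter (fun x : Fin L → Fin (numE G) => ¬ SplitOK H t i₀ x)).card : ℝ) ≤
      1 / 8 * (numE G : ℝ) ^ L := by
    have h := notSplit_card H hk hNK hN0 t i₀ L
    have h' : ((univ.filter (fun x : Fin L → Fin (numE G) => ¬ SplitOK H t i₀ x)).card : ℝ) * numE G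
      ≤ W * (numE G : ℝ) ^ L := by exact_mod_cast h
    have hW8 : (8:ℝ) * W ≤ numE G := by exact_mod_cast (by omega : 8 * W ≤ numE G)
    refine le_of_mul_le_mul_right (h'.trans ?_) hNr
    nlinarith
  have hpowk : (Q:ℝ) ^ k ≤ (Q:ℝ) ^ (2 * k) := pow_le_pow_right₀ hQr (by omega)
  have hpowk2 : (Q:ℝ) ^ (2 * k - 1) ≤ (Q:ℝ) ^ (2 * k) := pow_le_pow_right₀ hQr (by omega)
  have hμQ : k * μ * (Q:ℝ) ^ (2 * k) = 1 / 24 := by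
    rw [hμ]; field_simp
  have hμk : μ ≤ k * μ := le_mul_of_one_le_left hμ0.le hkr
  have b1 : ((univ.filter (fun x : Fin L → Fin (numE G) => ∃ U ∈ fam1 G H χ, BadSet H t x U)).card : ℝ) ≤
      1 / 24 * (numE G : ℝ) ^ L := by
    refine (badFam_real H hk hNK hN0 t L k _ (fam1_unif H χ) μ (fam1_card H χ hk μ hμ0.le hχ)).trans ?_
    rw [← hμQ]; gcongr
  have b2 : ((univ.filter (fun x : Fin L → Fin (numE G) => ∃ U ∈ fam2 G χ, BadSet H t x U)).card : ℝ) ≤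
      1 / 24 * (numE G : ℝ) ^ L := by
    refine (badFam_real H hk hNK hN0 t L (2 * k - 1) _ (fam2_unif χ) μ (fam2_card χ hk μ hμ0.le hχ)).trans ?_
    rw [← hμQ]; gcongr
  have b3 : ((univ.filter (fun x : Fin L → Fin (numE G) => ∃ U ∈ fam3 G χ, BadSet H t x U)).card : ℝ) ≤
      1 / 24 * (numE G : ℝ) ^ L := by
    refine (badFam_real H hk hNK hN0 t L (2 * k - 1) _ (fam3_unif χ) (k * μ) (fam3_card χ hk μ hμ0.le hχ)).trans ?_
    rw [← hμQ]; gcongr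
  have b4 : ((univ.filter (fun x : Fin L → Fin (numE G) => SplitOK H t i₀ x ∧
      ¬ G.MinDegOnGe j (splitVerts H t (idxSet i₀ x)) ((δ + 3 * ε / 4) * (MOf k t : ℝ) ^ d))).card : ℝ) ≤
      1 / 8 * (numE G : ℝ) ^ L := by
    have h := degFail H hk hNK t (by omega) ht0 (by omega : 0 < L) i₀ j d (by omega) (by omega) _
      ((δ + 3 * ε / 4) * (MOf k t : ℝ) ^ d) (d.factorial * (ε / 8) * (MOf k t : ℝ) ^ d) hdeg
      (by positivity) ?_
    · refine h.trans ?_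
      have hMM : (L + 1) * (t * (k - 1) + 1) = MOf k t := by
        rw [hL1, mul_comm]; rfl
      rw [hMM]
      calc _ = ((MOf k t : ℝ) ^ j * Real.exp (-((d.factorial * (ε / 8) * (MOf k t : ℝ) ^ d) ^ 2 /
        (2 * (L : ℕ) * ((d * (L ^ (d - 1) * (t * (k - 1)) ^ d) : ℕ) : ℝ) ^ 2)))) * (numE G : ℝ) ^ L := by
            ring
        _ ≤ _ := mul_le_mul_of_nonneg_right hP4 hNL.le
    · have e1 : L - j + 1 - d = m - k := by omega
      rw [e1, hNK]
      push_cast at hP3 ⊢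
      rw [mul_pow] at hP3
      have hfd : (0:ℝ) ≤ d.factorial * (numE G : ℝ) ^ d := by positivity
      have := mul_le_mul_of_nonneg_left hP3 hfd
      rw [mul_pow]
      nlinarith [this]
  set Good := univ.filter (fun x : Fin L → Fin (numE G) =>
      Function.Injective x ∧ (fun S =>
                    IsSplitting H t (insert i₀ S) ∧ (insert i₀ S).card = m ∧
                    Suitable χ ε m H t (insert i₀ S) i₀ ∧
                    G.MinDegOnGe j (splitVerts H t (insert i₀ S))
                      ((δ + 3 * ε / 4) * (MOf k t : ℝ) ^ d)) (univ.image (fun a => (x a : ℕ)))) with hGood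
  have hgood : (numE G : ℝ) ^ L / 2 ≤ (Good.card : ℝ) := by
    have hcov : (univ : Finset (Fin L → Fin (numE G))) ⊆ Good ∪
        (univ.filter (fun x : Fin L → Fin (numE G) => ¬ SplitOK H t i₀ x) ∪
        (univ.filter (fun x : Fin L → Fin (numE G) => ∃ U ∈ fam1 G H χ, BadSet H t x U) ∪
        (univ.filter (fun x : Fin L → Fin (numE G) => ∃ U ∈ fam2 G χ, BadSet H t x U) ∪
        (univ.filter (fun x : Fin L → Fin (numE G) => ∃ U ∈ fam3 G χ, BadSet H t x U) ∪
        (univ.filter (fun x : Fin L → Fin (numE G) => SplitOK H t i₀ x ∧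
      ¬ G.MinDegOnGe j (splitVerts H t (idxSet i₀ x)) ((δ + 3 * ε / 4) * (MOf k t : ℝ) ^ d))))))) := by
      intro x _
      by_contra hcon
      rw [mem_union, mem_union, mem_union, mem_union, mem_union] at hcon
      push Not at hcon
      obtain ⟨c0, c1, c2, c3, c4, c5⟩ := hcon
      have c1 : SplitOK H t i₀ x := by
        by_contra h; exact c1 (mem_filter.2 ⟨mem_univ _, h⟩)
      have c2 : ¬ ∃ U ∈ fam1 G H χ, BadSet H t x U := fun h => c2 (mem_filter.2 ⟨mem_univ _, h⟩)
      have c3 : ¬ ∃ U ∈ fam2 G χ, BadSet H t x U := fun h => c3 (mem_filter.2 ⟨mem_univ _, h⟩)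
      have c4 : ¬ ∃ U ∈ fam3 G χ, BadSet H t x U := fun h => c4 (mem_filter.2 ⟨mem_univ _, h⟩)
      have c5 : G.MinDegOnGe j (splitVerts H t (idxSet i₀ x)) ((δ + 3 * ε / 4) * (MOf k t : ℝ) ^ d) := by
        by_contra h; exact c5 (mem_filter.2 ⟨mem_univ _, c1, h⟩)
      have hsp := splitOK_split H t i₀ hi₀ x c1
      exact c0 (mem_filter.2 ⟨mem_univ _, splitOK_inj H t i₀ x c1, hsp,
        (splitOK_card H t i₀ x c1).trans hL1,
        suitable_of H χ hk ε m t i₀ x hP2 hsp c2 c3 c4, c5⟩)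
    have hc := card_le_card hcov
    rw [card_univ, Fintype.card_fun, Fintype.card_fin, Fintype.card_fin] at hc
    have hc2 := hc.trans ((card_union_le _ _).trans (Nat.add_le_add_left ((card_union_le _ _).trans
      (Nat.add_le_add_left ((card_union_le _ _).trans (Nat.add_le_add_left ((card_union_le _ _).trans
      (Nat.add_le_add_left (card_union_le _ _) _)) _)) _)) _))
    have hc3 : ((numE G ^ L : ℕ) : ℝ) ≤ _ := Nat.cast_le.2 hc2
    simp only [Nat.cast_add, Nat.cast_pow] at hc3
    linarith
  have hb := binom_const L (numE G) (by omega) hLN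
  have hmr : (L:ℝ) + 1 = m := by exact_mod_cast hL1
  rw [hmr] at hb
  have hq : (0:ℝ) ≤ 1 - (L:ℝ) / numE G := by linarith
  calc (1:ℝ) / m = (2 / m) / 2 := by ring
    _ ≤ (((L : ℝ) / numE G) ^ L * (1 - (L : ℝ) / numE G) ^ (numE G - L) * (numE G : ℝ) ^ L / L.factorial) / 2 := by
        gcongr
    _ = ((L : ℝ) / numE G) ^ L * (1 - (L : ℝ) / numE G) ^ (numE G - L) * ((numE G : ℝ) ^ L / 2) / L.factorial := by
        ring
    _ ≤ _ := by
        gcongr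
        refine hgood.trans (le_of_eq ?_)
        rw [hGood]
        congr!

end
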